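/- arXiv:2306.01702 — 2 statements merged into one kernel-verified Lean document; each statement's English description precedes it below -/
import Mathlib

section
/- Let (P, L, f) be a countable extended PO system, 𝒵 a bounded trim (P, L, f)-partition of the ω-Stone space W, Q a countable PO system, and α : Q → P a surjective morphism. Then there exists a trim Q-partition of W that regularly refines 𝒵 via α if and only if both: (1) α⁻¹(L) has a finite foundation in Q; and (2) |α⁻¹(p)| ≤ f(p) for every p ∈ L_min^d. -/
open Set Filter Topology

universe u v

/-- A PO system: a set with a transitive antisymmetric relation `<`. -/
structure POSystem (P : Type u) : Type u where
  lt : P → P → Prop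
  lt_trans : ∀ {a b c}, lt a b → lt b c → lt a c
  lt_antisymm : ∀ {a b}, lt a b → lt b a → a = b

namespace POSystem

variable {P : Type*} {Q : Type*}

/-- `a ≤ b` iff `a < b` or `a = b`. -/
def le (S : POSystem P) (a b : P) : Prop := S.lt a b ∨ a = b

theorem le_trans {S : POSystem P} {a b c : P} (h1 : S.le a b) (h2 : S.le b c) :
    S.le a c := by
  rcases h1 with h1 | rfl
  · rcases h2 with h2 | rfl
    · exact Or.inl (S.lt_trans h1 h2)
    · exact Or.inl h1
  · exact h2

/-- A morphism of PO systems. -/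
def IsMorphism (SQ : POSystem Q) (SP : POSystem P) (α : Q → P) : Prop :=
  ∀ q : Q, α '' {r | SQ.lt q r} = {p | SP.lt (α q) p}

/-- An isomorphism of PO systems. -/
def IsIso (SQ : POSystem Q) (SP : POSystem P) (β : Q → P) : Prop :=
  Function.Bijective β ∧ ∀ a b : Q, SQ.lt a b ↔ SP.lt (β a) (β b)

/-- An ideal of a PO system: a nonempty directed lower subset. -/
def IsIdeal (S : POSystem P) (J : Set P) : Prop :=
  J.Nonempty ∧ (∀ x ∈ J, ∀ y : P, S.le y x → y ∈ J) ∧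
    ∀ x ∈ J, ∀ y ∈ J, ∃ z ∈ J, S.le x z ∧ S.le y z

/-- An ideal of a subset `Qs` of a PO system. -/
def IsIdealOf (S : POSystem P) (Qs : Set P) (J : Set P) : Prop :=
  J.Nonempty ∧ J ⊆ Qs ∧ (∀ x ∈ J, ∀ y ∈ Qs, S.le y x → y ∈ J) ∧
    ∀ x ∈ J, ∀ y ∈ J, ∃ z ∈ J, S.le x z ∧ S.le y z

/-- The principal ideal `p↓`. -/
def principalIdeal (S : POSystem P) (p : P) : Set P := {q | S.le q p}

theorem principal_isIdeal (S : POSystem P) (p : P) : IsIdeal S (principalIdeal S p) :=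
  ⟨⟨p, Or.inr rfl⟩, fun _ hx y hy => le_trans hy hx,
    fun _ hx _ hy => ⟨p, Or.inr rfl, hx, hy⟩⟩

/-- `p` is the supremum of the subset `A`. -/
def IsSupOf (S : POSystem P) (p : P) (A : Set P) : Prop :=
  (∀ a ∈ A, S.le a p) ∧ ∀ q : P, (∀ a ∈ A, S.le a q) → S.le p q

/-- `p` is separated in `P` if it is not the supremum of a strictly increasing sequence. -/
def Separated (S : POSystem P) (p : P) : Prop :=
  ¬ ∃ u : ℕ → P, (∀ n, S.lt (u n) (u (n + 1)) ∧ u n ≠ u (n + 1)) ∧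
      IsSupOf S p (Set.range u)

/-- `p` is compact in `P`. -/
def CompactIn (S : POSystem P) (p : P) : Prop :=
  ∀ J : Set P, IsIdeal S J → ∀ s : P, IsSupOf S s J → S.le p s → p ∈ J

/-- The lower closure `N↓` of a subset. -/
def downSet (S : POSystem P) (N : Set P) : Set P := {p | ∃ q ∈ N, S.le p q}

/-- `N` has a finite foundation. -/
def HasFinFoundation (S : POSystem P) (N : Set P) : Prop :=
  ∃ F : Set P, F.Finite ∧ F ⊆ downSet S N ∧ ∀ r ∈ downSet S N, ∃ p ∈ F, S.le p r

def PDelta (S : POSystem P) : Set P := {p | HasFinFoundation S {p}}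

def IsLowerSubset (S : POSystem P) (L : Set P) : Prop :=
  ∀ p ∈ L, ∀ q : P, S.le q p → q ∈ L

/-- Minimal elements of `L`. -/
def minIn (S : POSystem P) (L : Set P) : Set P :=
  {p | p ∈ L ∧ ∀ q ∈ L, S.le q p → q = p}

/-- `L_min^d`: minimal elements of `L` lying in `P^d`. -/
def LminD (S : POSystem P) (L : Set P) : Set P := {p | p ∈ minIn S L ∧ ¬ S.lt p p}

/-- `(P, L, f)` is an extended PO system. -/
def IsExtPO (S : POSystem P) (L : Set P) (f : P → ℕ) : Prop :=
  IsLowerSubset S L ∧ L ⊆ PDelta S ∧ ∀ p ∈ LminD S L, 0 < f p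

/-- The order relation on the ideal completion `id(P)`: ordered by inclusion, with
`id(P)^d` the principal ideals `p↓` for `p ∈ P^d`. -/
def idLt (S : POSystem P) (J K : {J : Set P // IsIdeal S J}) : Prop :=
  (J.1 ⊆ K.1 ∧ J ≠ K) ∨ (J = K ∧ ¬ ∃ p : P, ¬ S.lt p p ∧ J.1 = principalIdeal S p)

/-- The ideal completion `id(P)` of a PO system. -/
def idPO (S : POSystem P) : POSystem {J : Set P // IsIdeal S J} where
  lt := idLt S
  lt_trans := by
    intro a b c h1 h2
    unfold idLt at h1 h2 ⊢
    rcases h1 with ⟨hab, hne⟩ | ⟨heq, h⟩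
    · rcases h2 with ⟨hbc, hne'⟩ | ⟨heq', h'⟩
      · refine Or.inl ⟨hab.trans hbc, fun hac => hne ?_⟩
        exact Subtype.ext (subset_antisymm hab (by rw [hac]; exact hbc))
      · rw [← heq']; exact Or.inl ⟨hab, hne⟩
    · rw [heq]; exact h2
  lt_antisymm := by
    intro a b h1 h2
    unfold idLt at h1 h2
    rcases h1 with ⟨hab, _⟩ | ⟨heq, _⟩
    · rcases h2 with ⟨hba, _⟩ | ⟨heq, _⟩
      · exact Subtype.ext (subset_antisymm hab hba)
      · exact heq.symm
    · exact heq

/-- The restriction of a PO system to a subset. -/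
def restrictPO (S : POSystem P) (T : Set P) : POSystem T where
  lt a b := S.lt a b
  lt_trans := fun h1 h2 => S.lt_trans h1 h2
  lt_antisymm := fun h1 h2 => Subtype.ext (S.lt_antisymm h1 h2)

end POSystem

open POSystem

section Partitions

variable {W : Type*} [TopologicalSpace W] {P : Type*} {Q : Type*}

/-- The derived set (set of limit points) of `A`. -/
def limitPts (A : Set W) : Set W := {x | x ∈ closure (A \ {x})}

/-- The type `T(A)` of a subset `A` with respect to a partition `X`. -/
def ptype (X : P → Set W) (A : Set W) : Set P := {p | (A ∩ X p).Nonempty}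

/-- A `P`-partition of `W`: pairwise disjoint nonempty sets `X p` such that
`(X p)' ∩ X = ⋃_{q < p} X q`. -/
def IsPPartition (S : POSystem P) (X : P → Set W) : Prop :=
  (∀ p, (X p).Nonempty) ∧ (Pairwise fun p q => Disjoint (X p) (X q)) ∧
    ∀ p, limitPts (X p) ∩ (⋃ q, X q) = ⋃ q ∈ {q : P | S.lt q p}, X q

/-- `A` is a `p`-trim set. -/
def IsTrimAt (S : POSystem P) (X : P → Set W) (A : Set W) (p : P) : Prop :=
  IsCompact A ∧ IsOpen A ∧ ptype X A = {q | S.le p q} ∧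
    (¬ S.lt p p → ∃! x, x ∈ A ∩ X p)

/-- `A` is a trim set. -/
def IsTrimSet (S : POSystem P) (X : P → Set W) (A : Set W) : Prop :=
  ∃ p, IsTrimAt S X A p

/-- `P̂`: the set of `p` for which some `p`-trim set exists. -/
def Phat (S : POSystem P) (X : P → Set W) : Set P := {p | ∃ A, IsTrimAt S X A p}

/-- Axiom T1: every point has a neighbourhood base of trim sets. -/
def HasTrimBases (S : POSystem P) (X : P → Set W) : Prop :=
  ∀ w : W, ∀ U ∈ nhds w, ∃ A, IsTrimSet S X A ∧ w ∈ A ∧ A ⊆ U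

/-- Axiom T2 (fullness). -/
def IsFull (S : POSystem P) (X : P → Set W) : Prop :=
  ∀ p ∈ Phat S X, ∀ w : W,
    (∀ U ∈ nhds w, ∃ A, IsTrimAt S X A p ∧ w ∈ A ∧ A ⊆ U) → w ∈ X p

/-- `w` is a clean point. -/
def IsCleanPt (S : POSystem P) (X : P → Set W) (w : W) : Prop :=
  ∃ p, w ∈ X p ∧ ∃ A, IsTrimAt S X A p ∧ w ∈ A

/-- Axiom T3: all points of `X` are clean. -/
def AllClean (S : POSystem P) (X : P → Set W) : Prop :=
  ∀ p : P, ∀ w ∈ X p, ∃ A, IsTrimAt S X A p ∧ w ∈ A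

/-- A trim `P`-partition. -/
def IsTrimPartition (S : POSystem P) (X : P → Set W) : Prop :=
  IsPPartition S X ∧ HasTrimBases S X ∧ IsFull S X ∧ AllClean S X

/-- A complete partition: the blocks cover `W`. -/
def IsCompletePartition (X : P → Set W) : Prop := (⋃ p, X p) = Set.univ

/-- `Y` refines `Z` via `α`. -/
def Refines (Y : Q → Set W) (Z : P → Set W) (α : Q → P) : Prop :=
  ∀ q, Y q ⊆ Z (α q)

/-- `Y` regularly refines `Z` via `α` (`Z` regularly consolidates `Y` via `α`). -/
def RegRefines (SQ : POSystem Q) (SP : POSystem P) (Y : Q → Set W) (Z : P → Set W)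
    (α : Q → P) : Prop :=
  Refines Y Z α ∧ ∀ p ∈ Phat SP Z, ∀ A : Set W, IsTrimAt SP Z A p → p ∈ α '' ptype Y A

/-- A semi-trim partition: T1, T2, and clean points are dense in each `X p`, `p ∈ P̂`. -/
def IsSemiTrim (S : POSystem P) (X : P → Set W) : Prop :=
  IsPPartition S X ∧ HasTrimBases S X ∧ IsFull S X ∧
    ∀ p ∈ Phat S X, X p ⊆ closure {w | w ∈ X p ∧ ∃ A, IsTrimAt S X A p ∧ w ∈ A}

/-- A strongly semi-trim partition: T1, T2, and all points of `X p` are clean, `p ∈ P̂`. -/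
def IsStronglySemiTrim (S : POSystem P) (X : P → Set W) : Prop :=
  IsPPartition S X ∧ HasTrimBases S X ∧ IsFull S X ∧
    ∀ p ∈ Phat S X, ∀ w ∈ X p, ∃ A, IsTrimAt S X A p ∧ w ∈ A

/-- The labels of a sequence are pairwise strictly incomparable or strictly increasing. -/
def PairwiseIncompOrStrictIncr (S : POSystem P) (τ : ℕ → P) : Prop :=
  (∀ j k, j ≠ k → ¬ S.le (τ j) (τ k)) ∨ (∀ j k, j < k → S.lt (τ j) (τ k) ∧ τ j ≠ τ k)

/-- A rank `P`-partition: a complete `P`-partition satisfying RP1 and RP2. -/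
def IsRankPartition (S : POSystem P) (X : P → Set W) : Prop :=
  IsPPartition S X ∧ IsCompletePartition X ∧
    (∀ q : P, Separated S q → ∀ (x : W) (u : ℕ → W) (τx : P) (τu : ℕ → P),
      x ∈ X τx → (∀ k, u k ∈ X (τu k)) →
      Filter.Tendsto u Filter.atTop (nhds x) → (∀ k, u k ≠ x) →
      S.le q τx → PairwiseIncompOrStrictIncr S τu →
      ∀ᶠ k in Filter.atTop, S.le q (τu k)) ∧
    (∀ (x : W) (τx : P), x ∈ X τx → ¬ Separated S τx →
      ∃ u : ℕ → W, Filter.Tendsto u Filter.atTop (nhds x) ∧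
        ∀ k, ∃ q, u k ∈ X q ∧ S.lt q τx ∧ q ≠ τx)

/-- `I_w`: the set of types of trim neighbourhoods of `w`. -/
def Iw (S : POSystem P) (X : P → Set W) (w : W) : Set P :=
  {p | ∃ A : Set W, IsTrimAt S X A p ∧ w ∈ A}

/-- A trim `(P, L, f)`-partition. -/
def IsTrimPLF (S : POSystem P) (L : Set P) (f : P → ℕ) (Z : P → Set W) : Prop :=
  IsTrimPartition S Z ∧ (∀ p, IsCompact (closure (Z p)) ↔ p ∈ L) ∧
    ∀ p ∈ LminD S L, Nat.card (Z p) = f p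

/-- A bounded trim `(P, L, f)`-partition. -/
def IsBoundedTrimPLF (S : POSystem P) (L : Set P) (f : P → ℕ) (Z : P → Set W) : Prop :=
  IsTrimPLF S L f Z ∧ IsCompact (closure (⋃ p ∈ L, Z p))

end Partitions

section Primitive

variable {W : Type*} [TopologicalSpace W]

/-- The ideal `(A)` of compact open subsets of `A`. -/
def coIdeal (A : Set W) : Set (Set W) := {C | IsCompact C ∧ IsOpen C ∧ C ⊆ A}

/-- `(A) ≅ (B)` as Boolean rings (equivalently, as posets). -/
def IdealIso (A B : Set W) : Prop := Nonempty (↥(coIdeal A) ≃o ↥(coIdeal B))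

/-- `(A) × (B) ≅ (A)`. -/
def ProdIdealIso (A B : Set W) : Prop :=
  Nonempty ((↥(coIdeal A) × ↥(coIdeal B)) ≃o ↥(coIdeal A))

/-- A compact open `A` is pseudo-indecomposable (PI). -/
def IsPISet (A : Set W) : Prop :=
  IsCompact A ∧ IsOpen A ∧ ∀ B : Set W, IsCompact B → IsOpen B → B ⊆ A →
    IdealIso B A ∨ IdealIso (A \ B) A

/-- `W` is primitive: every compact open set is a finite disjoint union of PI sets. -/
def PrimitiveSpace (W : Type*) [TopologicalSpace W] : Prop :=
  ∀ A : Set W, IsCompact A → IsOpen A →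
    ∃ (n : ℕ) (F : Fin n → Set W), (∀ i, IsPISet (F i)) ∧
      (Pairwise fun i j => Disjoint (F i) (F j)) ∧ A = ⋃ i, F i

/-- The setoid of PI compact opens up to isomorphism of their ideals. -/
def piIsoSetoid (W : Type*) [TopologicalSpace W] : Setoid {A : Set W // IsPISet A} where
  r A B := IdealIso A.1 B.1
  iseqv := ⟨fun _ => ⟨OrderIso.refl _⟩,
    fun h => h.elim fun e => ⟨e.symm⟩,
    fun h1 h2 => h1.elim fun e => h2.elim fun f => ⟨e.trans f⟩⟩

/-- The underlying set of the structure diagram `𝒮(W)`: isomorphism classes of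
PI compact open subsets of `W`. -/
def SDiagram (W : Type*) [TopologicalSpace W] : Type _ := Quotient (piIsoSetoid W)

/-- The relation on `𝒮(W)`: `[A] < [B]` iff `(A) × (B) ≅ (A)`. -/
def SDiagramLt {W : Type*} [TopologicalSpace W] (x y : SDiagram W) : Prop :=
  ∃ A B : {A : Set W // IsPISet A}, x = Quotient.mk (piIsoSetoid W) A ∧
    y = Quotient.mk (piIsoSetoid W) B ∧ ProdIdealIso A.1 B.1

/-- The blocks of the canonical partition `𝒳(W)`: points having a neighbourhood base
of compact open sets of class `p`. -/
def canonicalBlock {W : Type*} [TopologicalSpace W] (p : SDiagram W) : Set W :=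
  {w | ∀ U ∈ nhds w, ∃ A : {A : Set W // IsPISet A},
      Quotient.mk (piIsoSetoid W) A = p ∧ w ∈ A.1 ∧ A.1 ⊆ U}

/-- The setoid of points of `W` under the homeomorphism group. -/
def homeoSetoid (W : Type*) [TopologicalSpace W] : Setoid W where
  r w x := ∃ h : W ≃ₜ W, h w = x
  iseqv := ⟨fun w => ⟨Homeomorph.refl W, rfl⟩,
    fun h => h.elim fun e he => ⟨e.symm, by rw [← he, Homeomorph.symm_apply_apply]⟩,
    fun h1 h2 => h1.elim fun e he => h2.elim fun f hf =>
      ⟨e.trans f, by rw [Homeomorph.trans_apply, he, hf]⟩⟩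

end Primitive


section Helpers

variable {W : Type*} [TopologicalSpace W] {P : Type*} {Q : Type*}

theorem hlp_up {S : POSystem P} {X : P → Set W} (hX : IsPPartition S X) {B : Set W}
    (hB : IsOpen B) {w : W} (hw : w ∈ B) {p r : P} (hp : w ∈ X p) (hlt : S.lt p r) :
    ∃ v ∈ B, v ∈ X r ∧ v ≠ w := by
  have h1 : w ∈ ⋃ q ∈ {q : P | S.lt q r}, X q := by
    simp only [mem_iUnion]
    exact ⟨p, hlt, hp⟩
  rw [← hX.2.2 r] at h1
  have h2 : w ∈ closure (X r \ {w}) := h1.1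
  rw [mem_closure_iff] at h2
  obtain ⟨v, hv, hv1, hv2⟩ := h2 B hB hw
  exact ⟨v, hv, hv1, hv2⟩

theorem hlp_le_antisymm {S : POSystem P} {a b : P} (h1 : S.le a b) (h2 : S.le b a) : a = b := by
  rcases h1 with h1 | h1
  · rcases h2 with h2 | h2
    · exact S.lt_antisymm h1 h2
    · exact h2.symm
  · exact h1

theorem hlp_shrink {S : POSystem P} {X : P → Set W} (hX : IsPPartition S X) {A B : Set W} {p : P}
    (hA : IsTrimAt S X A p) (hBA : B ⊆ A) (hBc : IsCompact B) (hBo : IsOpen B)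
    {w : W} (hw : w ∈ B) (hwp : w ∈ X p) : IsTrimAt S X B p := by
  refine ⟨hBc, hBo, ?_, ?_⟩
  · apply subset_antisymm
    · rintro q ⟨v, hv, hvq⟩
      have : q ∈ ptype X A := ⟨v, hBA hv, hvq⟩
      rw [hA.2.2.1] at this
      exact this
    · rintro q (h | h)
      · obtain ⟨v, hv, hvq, -⟩ := hlp_up hX hBo hw hwp h
        exact ⟨v, hv, hvq⟩
      · subst h; exact ⟨w, hw, hwp⟩
  · intro hp
    obtain ⟨x, hx, hu⟩ := hA.2.2.2 hp
    refine ⟨w, ⟨hw, hwp⟩, ?_⟩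
    intro y hy
    rw [hu y ⟨hBA hy.1, hy.2⟩, hu w ⟨hBA hw, hwp⟩]

theorem hlp_mem_type {S : POSystem P} {X : P → Set W} {A : Set W} {p q : P}
    (hA : IsTrimAt S X A p) {w : W} (hw : w ∈ A) (hq : w ∈ X q) : S.le p q := by
  have : q ∈ ptype X A := ⟨w, hw, hq⟩
  rw [hA.2.2.1] at this
  exact this

theorem hlp_exists_pt {S : POSystem P} {X : P → Set W} {A : Set W} {p q : P}
    (hA : IsTrimAt S X A p) (h : S.le p q) : ∃ w ∈ A, w ∈ X q := by
  have : q ∈ ptype X A := by rw [hA.2.2.1]; exact h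
  exact this

/-- A labelled partition of `V` into trim sets. -/
def HGood (S : POSystem P) (Z : P → Set W) (α : Q → P) (V : Set W) (x : W → Set W × Q) : Prop :=
  ∀ w ∈ V, w ∈ (x w).1 ∧ (x w).1 ⊆ V ∧ (∀ w' ∈ (x w).1, x w' = x w) ∧
    IsTrimAt S Z (x w).1 (α (x w).2)

theorem hlp_glue {S : POSystem P} {Z : P → Set W} {α : Q → P} {ι : Type*} (N : W → ι)
    (x : ι → W → Set W × Q) (V : Set W) (h : ∀ i, HGood S Z α (V ∩ N ⁻¹' {i}) (x i)) :
    HGood S Z α V (fun w => x (N w) w) := by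
  intro w hw
  obtain ⟨h1, h2, h3, h4⟩ := h (N w) w ⟨hw, rfl⟩
  refine ⟨h1, fun v hv => (h2 hv).1, ?_, h4⟩
  intro v hv
  have : N v = N w := (h2 hv).2
  show x (N v) v = x (N w) w
  rw [this]
  exact h3 v hv

open Classical in
theorem hlp_glue2 {S : POSystem P} {Z : P → Set W} {α : Q → P} (C V : Set W)
    (x y : W → Set W × Q) (h1 : HGood S Z α (V ∩ C) x) (h2 : HGood S Z α (V \ C) y) :
    HGood S Z α V (fun w => if w ∈ C then x w else y w) := by
  have := hlp_glue (S := S) (Z := Z) (α := α) (fun w => w ∈ C) (fun i w => if i then x w else y w) V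
    (by
      intro i
      by_cases hi : i
      · have e : V ∩ (fun w => w ∈ C) ⁻¹' {i} = V ∩ C := by
          ext w; simp [hi]
        rw [e]; simpa [hi] using h1
      · have e : V ∩ (fun w => w ∈ C) ⁻¹' {i} = V \ C := by
          ext w; simp [hi]
        rw [e]; simpa [hi] using h2)
  exact this

open Classical in
theorem hlp_disj {S : POSystem P} {Z : P → Set W} [T2Space W] (hZ : IsTrimPartition S Z)
    {V : Set W} (hVc : IsCompact V) (hVo : IsOpen V) : ∃ x, HGood S Z (id : P → P) V x := by
  have key : ∀ (t : Finset (Set W × P)), (∀ y ∈ t, IsTrimAt S Z y.1 y.2) →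
      ∃ x, HGood S Z (id : P → P) (⋃ y ∈ t, y.1) x ∧
        IsCompact (⋃ y ∈ t, y.1) ∧ IsOpen (⋃ y ∈ t, y.1) := by
    intro t
    induction t using Finset.induction_on with
    | empty =>
      intro _
      by_cases hW : Nonempty (Set W × P)
      · obtain ⟨a⟩ := hW
        exact ⟨fun _ => a, by intro w hw; simp at hw, by simp, by simp⟩
      · by_cases hP : Nonempty P
        · exact absurd ⟨(∅, hP.some)⟩ hW
        · have : IsEmpty W := ⟨fun w => by
            obtain ⟨A, ⟨p, _⟩, _⟩ := hZ.2.1 w univ Filter.univ_mem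
            exact hP ⟨p⟩⟩
          exact ⟨fun w => (this.false w).elim, fun w => (this.false w).elim, by simp, by simp⟩
    | insert a t ha ih =>
      intro ht
      obtain ⟨x, hx, hc, ho⟩ := ih (fun y hy => ht y (Finset.mem_insert_of_mem hy))
      have hA := ht a (Finset.mem_insert_self _ _)
      rw [Finset.set_biUnion_insert]
      set T := ⋃ y ∈ t, y.1 with hT
      obtain ⟨A, p⟩ := a
      simp only at hA ⊢
      have hDc : IsCompact (A \ T) := hA.1.diff ho
      have hDo : IsOpen (A \ T) := hA.2.1.sdiff hc.isClosed
      refine Exists.imp (fun y hy => ⟨hy, hA.1.union hc, hA.2.1.union ho⟩) ?_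
      by_cases hp : ∃ w ∈ A \ T, w ∈ Z p
      · obtain ⟨w0, hw0, hw0p⟩ := hp
        have hD := hlp_shrink hZ.1 hA sdiff_subset hDc hDo hw0 hw0p
        refine ⟨fun w => if w ∈ T then x w else (A \ T, p), hlp_glue2 T _ _ _ ?_ ?_⟩
        · have : (A ∪ T) ∩ T = T := by ext w; simp; tauto
          rw [this]; exact hx
        · have : (A ∪ T) \ T = A \ T := by ext; simp
          rw [this]
          intro w hw
          exact ⟨hw, subset_rfl, fun _ _ => rfl, hD⟩
      · push Not at hp
        obtain ⟨w0, hw0, hw0p⟩ := hlp_exists_pt hA (Or.inr rfl : S.le p p)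
        have hw0T : w0 ∈ T := by
          by_contra h
          exact hp w0 ⟨hw0, h⟩ hw0p
        obtain ⟨g1, g2, g3, g4⟩ := hx w0 hw0T
        set B := (x w0).1 with hB
        set b := (x w0).2 with hb
        have hbp : S.le b p := hlp_mem_type g4 g1 hw0p
        have hBD : IsTrimAt S Z (B ∪ (A \ T)) b := by
          refine ⟨g4.1.union hDc, g4.2.1.union hDo, ?_, ?_⟩
          · apply subset_antisymm
            · rintro q ⟨v, hv | hv, hvq⟩
              · exact hlp_mem_type g4 hv hvq
              · exact POSystem.le_trans hbp (hlp_mem_type hA hv.1 hvq)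
            · intro q hq
              obtain ⟨v, hv, hvq⟩ := hlp_exists_pt g4 hq
              exact ⟨v, Or.inl hv, hvq⟩
          · intro hbb
            obtain ⟨v, hv, hu⟩ := g4.2.2.2 hbb
            refine ⟨v, ⟨Or.inl hv.1, hv.2⟩, ?_⟩
            rintro y ⟨hy | hy, hyb⟩
            · exact hu y ⟨hy, hyb⟩
            · exfalso
              have h1 : S.le p b := hlp_mem_type hA hy.1 hyb
              have h2 := hlp_le_antisymm h1 hbp
              exact hp y hy (by rw [h2]; exact hyb)
        refine ⟨_, hlp_glue2 (B ∪ (A \ T)) _ (fun _ => (B ∪ (A \ T), b)) x ?_ ?_⟩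
        · intro w hw
          have hs : B ∪ A \ T ⊆ A ∪ T := by
            rintro v (hv | hv)
            · exact Or.inr (g2 hv)
            · exact Or.inl hv.1
          exact ⟨hw.2, fun v hv => ⟨hs hv, hv⟩, fun _ _ => rfl, hBD⟩
        · rintro w ⟨hw1, hw2⟩
          have hwT : w ∈ T := by
            by_contra h
            rcases hw1 with hw1 | hw1
            · exact hw2 (Or.inr ⟨hw1, h⟩)
            · exact h hw1
          obtain ⟨k1, k2, k3, k4⟩ := hx w hwT
          refine ⟨k1, ?_, k3, k4⟩
          intro v hv
          refine ⟨Or.inr (k2 hv), ?_⟩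
          rintro (h | h)
          · have e1 := k3 v hv
            have e2 := g3 v h
            rw [e1] at e2
            apply hw2
            left
            rw [hB, ← e2]
            exact k1
          · exact h.2 (k2 hv)
  have h1 : ∀ w, ∃ A p, IsTrimAt S Z A p ∧ w ∈ A ∧ (w ∈ V → A ⊆ V) := by
    intro w
    by_cases hw : w ∈ V
    · obtain ⟨A, ⟨p, h⟩, h2, h3⟩ := hZ.2.1 w V (hVo.mem_nhds hw)
      exact ⟨A, p, h, h2, fun _ => h3⟩
    · obtain ⟨A, ⟨p, h⟩, h2, h3⟩ := hZ.2.1 w univ Filter.univ_mem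
      exact ⟨A, p, h, h2, fun h => absurd h hw⟩
  choose A p hp hwA hAV using h1
  obtain ⟨t, ht1, ht2⟩ := hVc.elim_nhds_subcover A
    (fun w _ => (hp w).2.1.mem_nhds (hwA w))
  obtain ⟨x, hx, -⟩ := key (t.image fun w => (A w, p w)) (by
    intro y hy
    simp only [Finset.mem_image] at hy
    obtain ⟨w, hw, rfl⟩ := hy
    exact hp w)
  have e : (⋃ y ∈ t.image fun w => (A w, p w), y.1) = V := by
    apply subset_antisymm
    · intro v hv
      simp only [Finset.mem_image, mem_iUnion] at hv
      obtain ⟨_, ⟨w, hw, rfl⟩, hv⟩ := hv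
      exact hAV w (ht1 w hw) hv
    · intro v hv
      have := ht2 hv
      simp only [mem_iUnion] at this
      obtain ⟨w, hw, hv⟩ := this
      simp only [Finset.mem_image, mem_iUnion]
      exact ⟨_, ⟨w, hw, rfl⟩, hv⟩
  rw [e] at hx
  exact ⟨x, hx⟩


open Classical in
theorem hlp_refine {SP : POSystem P} {SQ : POSystem Q} {Z : P → Set W} {α : Q → P} [T2Space W]
    (hZ : IsTrimPartition SP Z) (hmor : POSystem.IsMorphism SQ SP α)
    {A : Set W} {q : Q} (hA : IsTrimAt SP Z A (α q)) {C : Set W} (hC : IsClopen C) :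
    ∃ y : W → Set W × Q, HGood SP Z α A y ∧ (∀ w ∈ A, SQ.le q (y w).2) ∧
      (∀ w ∈ A, w ∈ C → (y w).1 ⊆ C) ∧ (∃ w ∈ A, (y w).2 = q) ∧
      (¬ SQ.lt q q → ∀ w ∈ A, ∀ w' ∈ A, (y w).2 = q → (y w').2 = q → y w = y w') := by
  obtain ⟨x1, hx1⟩ := hlp_disj hZ (hA.1.inter_right hC.1) (hA.2.1.inter hC.2)
  obtain ⟨x2, hx2⟩ := hlp_disj hZ (hA.1.diff hC.2) (hA.2.1.sdiff hC.1)
  obtain ⟨x, hx, hxC⟩ : ∃ x, HGood SP Z (id : P → P) A x ∧ ∀ w ∈ A, w ∈ C → (x w).1 ⊆ C := by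
    refine ⟨_, hlp_glue2 C A x1 x2 hx1 hx2, ?_⟩
    intro w hw hwC
    simp only [hwC, if_true]
    exact (hx1 w ⟨hw, hwC⟩).2.1.trans inter_subset_right
  obtain ⟨w0, hw0, hw0q⟩ := hlp_exists_pt hA (Or.inr rfl : SP.le (α q) (α q))
  have hle : ∀ w ∈ A, SP.le (α q) (x w).2 := by
    intro w hw
    obtain ⟨k1, k2, k3, k4⟩ := hx w hw
    obtain ⟨v, hv, hvp⟩ := hlp_exists_pt k4 (Or.inr rfl : SP.le (x w).2 (x w).2)
    exact hlp_mem_type hA (k2 hv) hvp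
  have h0 : (x w0).2 = α q := by
    refine hlp_le_antisymm ?_ (hle w0 hw0)
    obtain ⟨k1, k2, k3, k4⟩ := hx w0 hw0
    exact hlp_mem_type k4 k1 hw0q
  have hlt : ∀ w ∈ A, x w ≠ x w0 → SP.lt (α q) (x w).2 := by
    intro w hw hne
    rcases hle w hw with h | h
    · exact h
    · by_cases hqq : SP.lt (α q) (α q)
      · rw [← h]; exact hqq
      · exfalso
        obtain ⟨k1, k2, k3, k4⟩ := hx w hw
        obtain ⟨v, hv, hvp⟩ := hlp_exists_pt k4 (Or.inr rfl : SP.le (x w).2 (x w).2)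
        rw [← h] at hvp
        obtain ⟨z, hz, hu⟩ := hA.2.2.2 hqq
        have : v = w0 := by rw [hu v ⟨k2 hv, hvp⟩, hu w0 ⟨hw0, hw0q⟩]
        rw [this] at hv
        exact hne (k3 _ hv).symm
  have hg : ∀ p, ∃ r, SP.lt (α q) p → SQ.lt q r ∧ α r = p := by
    intro p
    by_cases h : SP.lt (α q) p
    · have : p ∈ α '' {r | SQ.lt q r} := by rw [hmor q]; exact h
      obtain ⟨r, hr, e⟩ := this
      exact ⟨r, fun _ => ⟨hr, e⟩⟩
    · exact ⟨q, fun h' => absurd h' h⟩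
  choose g hg using hg
  let φ : Set W × P → Set W × Q := fun a => (a.1, if a = x w0 then q else g a.2)
  have hφ : ∀ w ∈ A, x w ≠ x w0 → SQ.lt q (φ (x w)).2 ∧ α (φ (x w)).2 = (x w).2 := by
    intro w hw hne
    simp only [φ, hne, if_false]
    exact hg _ (hlt w hw hne)
  have hφ0 : (φ (x w0)).2 = q := by simp [φ]
  refine ⟨fun w => φ (x w), ?_, ?_, ?_, ⟨w0, hw0, hφ0⟩, ?_⟩
  · intro w hw
    obtain ⟨k1, k2, k3, k4⟩ := hx w hw
    refine ⟨k1, k2, fun w' hw' => ?_, ?_⟩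
    · show φ (x w') = φ (x w)
      rw [k3 w' hw']
    · show IsTrimAt SP Z (x w).1 (α (φ (x w)).2)
      by_cases hne : x w = x w0
      · rw [hne, hφ0, ← h0]
        rw [hne] at k4
        exact k4
      · rw [(hφ w hw hne).2]; exact k4
  · intro w hw
    by_cases hne : x w = x w0
    · right; show q = (φ (x w)).2
      rw [hne, hφ0]
    · left; exact (hφ w hw hne).1
  · exact hxC
  · intro hqq
    have : ∀ w ∈ A, (φ (x w)).2 = q → x w = x w0 := by
      intro w hw h
      by_contra hne
      have := (hφ w hw hne).1
      rw [h] at this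
      exact hqq this
    intro w hw w' hw' h h'
    show φ (x w) = φ (x w')
    rw [this w hw h, this w' hw' h']

theorem hlp_small {SP : POSystem P} {Z : P → Set W} [T2Space W]
    (hZ : IsTrimPartition SP Z) {p : P} {u : W} (hu : u ∈ Z p) {U : Set W} (hU : IsOpen U)
    (huU : u ∈ U) : ∃ B, IsTrimAt SP Z B p ∧ u ∈ B ∧ B ⊆ U := by
  obtain ⟨A, hA, huA⟩ := hZ.2.2.2 p u hu
  obtain ⟨B, ⟨p', hB⟩, huB, hBU⟩ := hZ.2.1 u (A ∩ U) ((hA.2.1.inter hU).mem_nhds ⟨huA, huU⟩)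
  exact ⟨B, hlp_shrink hZ.1 hA (hBU.trans inter_subset_left) hB.1 hB.2.1 huB hu, huB,
    hBU.trans inter_subset_right⟩

open Classical in
theorem hlp_step {SP : POSystem P} {SQ : POSystem Q} {Z : P → Set W} {α : Q → P} [T2Space W]
    (hZ : IsTrimPartition SP Z) (hmor : POSystem.IsMorphism SQ SP α)
    {A : Set W} {q : Q} (hA : IsTrimAt SP Z A (α q)) {C : Set W} (hC : IsClopen C) (r : Q) :
    ∃ y : W → Set W × Q, HGood SP Z α A y ∧ (∀ w ∈ A, SQ.le q (y w).2) ∧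
      (∀ w ∈ A, w ∈ C → (y w).1 ⊆ C) ∧ (∃ w ∈ A, (y w).2 = q) ∧
      (¬ SQ.lt q q → ∀ w ∈ A, ∀ w' ∈ A, (y w).2 = q → (y w').2 = q → y w = y w') ∧
      (SQ.lt q r → ∃ w ∈ A, ∃ w' ∈ A, (y w).2 = r ∧ (y w').2 = q ∧ w ∉ (y w').1) := by
  by_cases hqr : SQ.lt q r
  swap
  · obtain ⟨y, h1, h2, h3, h4, h5⟩ := hlp_refine hZ hmor hA hC
    exact ⟨y, h1, h2, h3, h4, h5, fun h => absurd h hqr⟩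
  have hlt : SP.lt (α q) (α r) := by
    have : α r ∈ α '' {r | SQ.lt q r} := ⟨r, hqr, rfl⟩
    rw [hmor q] at this
    exact this
  obtain ⟨v, hv, hvq⟩ := hlp_exists_pt hA (Or.inr rfl : SP.le (α q) (α q))
  obtain ⟨u, hu, hur, huv⟩ := hlp_up hZ.1 hA.2.1 hv hvq hlt
  obtain ⟨B, hB, huB, hBA⟩ := hlp_small hZ hur (U := A \ {v})
    (hA.2.1.sdiff isClosed_singleton) ⟨hu, huv⟩
  have hvB : v ∉ B := fun h => (hBA h).2 rfl
  have hBA' : B ⊆ A := fun w hw => (hBA hw).1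
  have hD : IsTrimAt SP Z (A \ B) (α q) := hlp_shrink hZ.1 hA sdiff_subset
    (hA.1.diff hB.2.1) (hA.2.1.sdiff hB.1.isClosed) ⟨hv, hvB⟩ hvq
  obtain ⟨y1, a1, a2, a3, ⟨w1, hw1, a4⟩, a5⟩ := hlp_refine hZ hmor hB hC
  obtain ⟨y2, b1, b2, b3, ⟨w2, hw2, b4⟩, b5⟩ := hlp_refine hZ hmor hD hC
  have hAB : A ∩ B = B := inter_eq_right.2 hBA'
  refine ⟨fun w => if w ∈ B then y1 w else y2 w,
    hlp_glue2 B A y1 y2 (by rw [hAB]; exact a1) b1, ?_, ?_, ?_, ?_, ?_⟩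
  · intro w hw
    by_cases hwB : w ∈ B
    · simp only [hwB, if_true]
      exact POSystem.le_trans (Or.inl hqr) (a2 w hwB)
    · simp only [hwB, if_false]
      exact b2 w ⟨hw, hwB⟩
  · intro w hw hwC
    by_cases hwB : w ∈ B
    · simp only [hwB, if_true]
      exact a3 w hwB hwC
    · simp only [hwB, if_false]
      exact b3 w ⟨hw, hwB⟩ hwC
  · refine ⟨w2, hw2.1, ?_⟩
    simp only [hw2.2, if_false]
    exact b4
  · intro hqq
    have : ∀ w ∈ A, (if w ∈ B then y1 w else y2 w).2 = q → w ∉ B := by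
      intro w hw h hwB
      simp only [hwB, if_true] at h
      have h1 := a2 w hwB
      rw [h] at h1
      have := hlp_le_antisymm h1 (Or.inl hqr)
      rw [this] at hqr
      exact hqq hqr
    intro w hw w' hw' h h'
    have k := this w hw h
    have k' := this w' hw' h'
    simp only [k, k', if_false] at h h' ⊢
    exact b5 hqq w ⟨hw, k⟩ w' ⟨hw', k'⟩ h h'
  · intro _
    refine ⟨w1, hBA' hw1, w2, hw2.1, ?_, ?_, ?_⟩
    · simp only [hw1, if_true]; exact a4
    · simp only [hw2.2, if_false]; exact b4
    · simp only [hw2.2, if_false]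
      intro h
      exact ((b1 w2 hw2).2.1 h).2 hw1

theorem hlp_init {SP : POSystem P} {Z : P → Set W} {α : Q → P} [T2Space W]
    (hZ : IsTrimPartition SP Z) (hsurj : Function.Surjective α) {F : Set Q} (hF : F.Finite) :
    ∀ (u : Q → W) (V : Set W), IsCompact V → IsOpen V → InjOn u F →
      (∀ q ∈ F, u q ∈ V ∧ u q ∈ Z (α q)) →
      ∃ x, HGood SP Z α V x ∧ ∀ q ∈ F, ∃ w ∈ V, (x w).2 = q := by
  classical
  induction F, hF using Set.Finite.induction_on with
  | empty =>
    intro u V hVc hVo _ _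
    obtain ⟨x, hx⟩ := hlp_disj hZ hVc hVo
    refine ⟨fun w => ((x w).1, Function.surjInv hsurj (x w).2), ?_, by simp⟩
    intro w hw
    obtain ⟨k1, k2, k3, k4⟩ := hx w hw
    refine ⟨k1, k2, fun w' hw' => ?_, ?_⟩
    · show ((x w').1, Function.surjInv hsurj (x w').2) = _
      rw [k3 w' hw']
    · show IsTrimAt SP Z (x w).1 (α (Function.surjInv hsurj (x w).2))
      rw [Function.surjInv_eq hsurj]; exact k4
  | @insert a F ha hF ih =>
    intro u V hVc hVo hinj hu
    obtain ⟨h1, h2⟩ := hu a (mem_insert _ _)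
    have hne : u a ∉ u '' F := by
      rintro ⟨b, hb, e⟩
      have := hinj (mem_insert_of_mem _ hb) (mem_insert _ _) e
      subst this
      exact ha hb
    obtain ⟨B, hB, haB, hBV⟩ := hlp_small hZ h2 (U := V \ (u '' F))
      (hVo.sdiff (hF.image u).isClosed) ⟨h1, hne⟩
    obtain ⟨x, hx, hxF⟩ := ih u (V \ B) (hVc.diff hB.2.1) (hVo.sdiff hB.1.isClosed)
      (hinj.mono (subset_insert _ _)) (by
        intro q hq
        refine ⟨⟨(hu q (mem_insert_of_mem _ hq)).1, fun h => ?_⟩, (hu q (mem_insert_of_mem _ hq)).2⟩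
        exact (hBV h).2 ⟨q, hq, rfl⟩)
    have hVB : V ∩ B = B := inter_eq_right.2 fun w hw => (hBV hw).1
    refine ⟨_, hlp_glue2 B V (fun _ => (B, a)) x ?_ hx, ?_⟩
    · rw [hVB]
      intro w hw
      exact ⟨hw, subset_rfl, fun _ _ => rfl, hB⟩
    · rintro q (rfl | hq)
      · exact ⟨u q, h1, by simp [haB]⟩
      · obtain ⟨w, hw, e⟩ := hxF q hq
        exact ⟨w, hw.1, by simp [hw.2, e]⟩


theorem hlp_final {SP : POSystem P} {SQ : POSystem Q} {Z : P → Set W} {α : Q → P} [T2Space W]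
    (hZ : IsTrimPartition SP Z) (C : ℕ → Set W) (r : ℕ → Q) (x : ℕ → W → Set W × Q)
    (hC : ∀ w : W, ∀ U ∈ nhds w, ∃ n, w ∈ C n ∧ C n ⊆ U)
    (hr : ∀ q n, ∃ m, n ≤ m ∧ r m = q)
    (H0 : ∀ n, HGood SP Z α univ (x n))
    (H1 : ∀ n w, (x (n + 1) w).1 ⊆ (x n w).1)
    (H2 : ∀ n w, SQ.le (x n w).2 (x (n + 1) w).2)
    (H3 : ∀ n w, w ∈ C n → (x (n + 1) w).1 ⊆ C n)
    (H4 : ∀ n w, ∃ w' ∈ (x n w).1, (x (n + 1) w').2 = (x n w).2)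
    (H5 : ∀ n w, ¬ SQ.lt (x n w).2 (x n w).2 → ∀ w1 ∈ (x n w).1, ∀ w2 ∈ (x n w).1,
      (x (n + 1) w1).2 = (x n w).2 → (x (n + 1) w2).2 = (x n w).2 → x (n + 1) w1 = x (n + 1) w2)
    (H6 : ∀ n w, SQ.lt (x n w).2 (r n) → ∃ w1 ∈ (x n w).1, ∃ w2 ∈ (x n w).1,
      (x (n + 1) w1).2 = r n ∧ (x (n + 1) w2).2 = (x n w).2 ∧ w1 ∉ (x (n + 1) w2).1)
    (H7 : ∀ q, ∃ w, SQ.le (x 0 w).2 q) :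
    ∃ Y : Q → Set W, IsTrimPartition SQ Y ∧ RegRefines SQ SP Y Z α := by
  have hself : ∀ n w, w ∈ (x n w).1 := fun n w => (H0 n w trivial).1
  have heq : ∀ n w, ∀ w' ∈ (x n w).1, x n w' = x n w := fun n w => (H0 n w trivial).2.2.1
  have htrim : ∀ n w, IsTrimAt SP Z (x n w).1 (α (x n w).2) := fun n w => (H0 n w trivial).2.2.2
  have hopen : ∀ n w, IsOpen (x n w).1 := fun n w => (htrim n w).2.1
  have hcomp : ∀ n w, IsCompact (x n w).1 := fun n w => (htrim n w).1
  have hmono1 : ∀ n m w, n ≤ m → (x m w).1 ⊆ (x n w).1 := by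
    intro n m w h
    induction m, h using Nat.le_induction with
    | base => exact subset_rfl
    | succ m _ ih => exact (H1 m w).trans ih
  have hmono2 : ∀ n m w, n ≤ m → SQ.le (x n w).2 (x m w).2 := by
    intro n m w h
    induction m, h using Nat.le_induction with
    | base => exact Or.inr rfl
    | succ m _ ih => exact POSystem.le_trans ih (H2 m w)
  have hmesh : ∀ w : W, ∀ U ∈ nhds w, ∃ n, ∀ m, n ≤ m → (x m w).1 ⊆ U := by
    intro w U hU
    obtain ⟨n, h1, h2⟩ := hC w U hU
    exact ⟨n + 1, fun m hm => (hmono1 _ _ w hm).trans ((H3 n w h1).trans h2)⟩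
  let Y : Q → Set W := fun q => {w | ∃ n, ∀ m, n ≤ m → (x m w).2 = q}
  -- labels of points of `Y q` are below `q`
  have hYle : ∀ q w n, w ∈ Y q → SQ.le (x n w).2 q := by
    rintro q w n ⟨k, hk⟩
    have := hmono2 n (max n k) w (le_max_left _ _)
    rwa [hk _ (le_max_right _ _)] at this
  have hYeq : ∀ q w n, w ∈ Y q → (x n w).2 = q → ∀ m, n ≤ m → (x m w).2 = q := by
    intro q w n hw h m hm
    have h1 := hmono2 n m w hm
    rw [h] at h1
    exact hlp_le_antisymm (hYle q w m hw) h1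
  have hN : ∀ n w, ∃ v ∈ (x n w).1, v ∈ Y (x n w).2 := by
    intro n w
    set q := (x n w).2 with hq
    let D : ℕ → Set W := fun k => {v | v ∈ (x n w).1 ∧ (x (n + k) v).2 = q}
    have hDne : ∀ k, (D k).Nonempty := by
      intro k
      induction k with
      | zero => exact ⟨w, hself n w, rfl⟩
      | succ k ih =>
        obtain ⟨v, hv1, hv2⟩ := ih
        obtain ⟨v', h1, h2⟩ := H4 (n + k) v
        refine ⟨v', ?_, ?_⟩
        · have := hmono1 n (n + k) v (by omega) h1
          rwa [heq n w v hv1] at this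
        · rw [hv2] at h2; exact h2
    have hDsub : ∀ k, D (k + 1) ⊆ D k := by
      rintro k v ⟨h1, h2⟩
      refine ⟨h1, ?_⟩
      have e1 := hmono2 n (n + k) v (by omega)
      rw [heq n w v h1] at e1
      have e2 := H2 (n + k) v
      have h2' : (x (n + k + 1) v).2 = q := h2
      rw [h2'] at e2
      exact hlp_le_antisymm e2 e1
    have hDcl : ∀ k, IsClosed (D k) := by
      intro k
      rw [← isOpen_compl_iff, isOpen_iff_mem_nhds]
      intro v hv
      by_cases hvA : v ∈ (x n w).1
      · filter_upwards [(hopen (n + k) v).mem_nhds (hself _ v)] with v' hv'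
        rintro ⟨_, g2⟩
        apply hv
        refine ⟨hvA, ?_⟩
        rw [heq _ _ v' hv'] at g2
        exact g2
      · filter_upwards [(hcomp n w).isClosed.isOpen_compl.mem_nhds hvA] with v' hv' h
        exact hv' h.1
    obtain ⟨v, hv⟩ := IsCompact.nonempty_iInter_of_sequence_nonempty_isCompact_isClosed D
      hDsub hDne ((hcomp n w).of_isClosed_subset (hDcl 0) (fun v hv => hv.1)) hDcl
    rw [mem_iInter] at hv
    refine ⟨v, (hv 0).1, n, fun m hm => ?_⟩
    obtain ⟨k, rfl⟩ := Nat.exists_eq_add_of_le hm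
    exact (hv k).2
  -- two distinct points
  have h2pt : ∀ n w s, SQ.lt (x n w).2 s → ∃ u ∈ (x n w).1, ∃ v ∈ (x n w).1,
      u ∈ Y s ∧ v ∈ Y (x n w).2 ∧ u ≠ v := by
    intro n w s hs
    obtain ⟨a, ha, haY⟩ := hN n w
    obtain ⟨m, hm, rfl⟩ := hr s n
    have hlab := hYeq _ a n haY (by rw [heq n w a ha]) m hm
    obtain ⟨w1, hw1, w2, hw2, e1, e2, hne⟩ := H6 m a (by rw [hlab]; exact hs)
    have hsub : (x m a).1 ⊆ (x n w).1 := by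
      have := hmono1 n m a hm
      rwa [heq n w a ha] at this
    have hs1 : (x (m + 1) w1).1 ⊆ (x n w).1 := by
      have := H1 m w1
      rw [heq m a w1 hw1] at this
      exact this.trans hsub
    have hs2 : (x (m + 1) w2).1 ⊆ (x n w).1 := by
      have := H1 m w2
      rw [heq m a w2 hw2] at this
      exact this.trans hsub
    obtain ⟨u, hu, huY⟩ := hN (m + 1) w1
    obtain ⟨v, hv, hvY⟩ := hN (m + 1) w2
    rw [e1] at huY
    rw [e2, hlab] at hvY
    refine ⟨u, hs1 hu, v, hs2 hv, huY, hvY, ?_⟩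
    rintro rfl
    apply hne
    rw [← heq _ _ _ hv, heq _ _ _ hu]
    exact hself _ _
  have hcell : ∀ n w, IsTrimAt SQ Y (x n w).1 (x n w).2 := by
    intro n w
    refine ⟨hcomp n w, hopen n w, ?_, ?_⟩
    · apply subset_antisymm
      · rintro s ⟨v, hv, hvs⟩
        have := hYle s v n hvs
        rw [heq n w v hv] at this
        exact this
      · rintro s (hs | hs)
        · obtain ⟨u, hu, -, -, huY, -⟩ := h2pt n w s hs
          exact ⟨u, hu, huY⟩
        · subst hs
          exact hN n w
    · intro hqq
      obtain ⟨v, hv, hvY⟩ := hN n w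
      refine ⟨v, ⟨hv, hvY⟩, ?_⟩
      rintro u ⟨hu, huY⟩
      by_contra hne
      have hall : ∀ m, n ≤ m → x m u = x m v := by
        intro m hm
        induction m, hm using Nat.le_induction with
        | base => rw [heq n w u hu, heq n w v hv]
        | succ m hm ih =>
          have l1 := hYeq _ v n hvY (by rw [heq n w v hv])
          have l2 := hYeq _ u n huY (by rw [heq n w u hu])
          refine H5 m v ?_ u ?_ v (hself m v) ?_ ?_
          · rw [l1 m hm]; exact hqq
          · rw [← ih]; exact hself m u
          · rw [l2 (m + 1) (by omega), l1 m hm]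
          · rw [l1 (m + 1) (by omega), l1 m hm]
      obtain ⟨k, hk⟩ := hmesh u {v}ᶜ (isOpen_compl_singleton.mem_nhds hne)
      have h1 := hk (max n k) (le_max_right _ _)
      rw [hall _ (le_max_left _ _)] at h1
      exact h1 (hself _ v) rfl
  have hdisj : ∀ q s w, w ∈ Y q → w ∈ Y s → q = s := by
    rintro q s w ⟨n, hn⟩ ⟨m, hm⟩
    rw [← hn (max n m) (le_max_left _ _), hm (max n m) (le_max_right _ _)]
  refine ⟨Y, ⟨⟨?_, ?_, ?_⟩, ?_, ?_, ?_⟩, ?_, ?_⟩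
  · intro q
    obtain ⟨w, hw⟩ := H7 q
    obtain ⟨v, -, hv⟩ := hlp_exists_pt (hcell 0 w) hw
    exact ⟨v, hv⟩
  · intro q s hqs
    rw [Set.disjoint_left]
    exact fun w h1 h2 => hqs (hdisj q s w h1 h2)
  · intro q
    apply subset_antisymm
    · rintro w ⟨hw1, hw2⟩
      rw [mem_iUnion] at hw2
      obtain ⟨s, hs⟩ := hw2
      simp only [mem_iUnion]
      refine ⟨s, ?_, hs⟩
      obtain ⟨n, hn⟩ := hs
      have hs : w ∈ Y s := ⟨n, hn⟩
      have hw1' : w ∈ closure (Y q \ {w}) := hw1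
      obtain ⟨v, hv, hvY, hvw⟩ := mem_closure_iff.1 hw1' _ (hopen n w) (hself n w)
      have hc := hcell n w
      rw [hn n le_rfl] at hc
      rcases hlp_mem_type hc hv hvY with h | h
      · exact h
      · subst h
        by_contra hss
        obtain ⟨z, hz, hu⟩ := hc.2.2.2 hss
        apply hvw
        show v = w
        rw [hu v ⟨hv, hvY⟩, hu w ⟨hself n w, hs⟩]
    · intro w hw
      simp only [mem_iUnion] at hw
      obtain ⟨s, hsq, hs⟩ := hw
      refine ⟨?_, mem_iUnion.2 ⟨s, hs⟩⟩
      show w ∈ closure (Y q \ {w})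
      rw [mem_closure_iff]
      intro U hU hwU
      obtain ⟨n, hn⟩ := hs
      obtain ⟨k, hk⟩ := hmesh w U (hU.mem_nhds hwU)
      have hsub := hk (max n k) (le_max_right _ _)
      have hlab := hn (max n k) (le_max_left _ _)
      obtain ⟨u, hu, v, hv, huY, hvY, huv⟩ := h2pt (max n k) w q (by rw [hlab]; exact hsq)
      rw [hlab] at hvY
      by_cases huw : u = w
      · have : v ∈ Y q := by
          have e : s = q := hdisj s q w ⟨n, hn⟩ (by rw [← huw]; exact huY)
          rw [← e]; exact hvY
        refine ⟨v, hsub hv, this, ?_⟩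
        rintro rfl
        exact huv huw
      · exact ⟨u, hsub hu, huY, huw⟩
  · intro w U hU
    obtain ⟨n, hn⟩ := hmesh w U hU
    exact ⟨_, ⟨_, hcell n w⟩, hself n w, hn n le_rfl⟩
  · intro q _ w hw
    obtain ⟨B, hB, hwB, -⟩ := hw univ Filter.univ_mem
    obtain ⟨n, hn⟩ := hmesh w B (hB.2.1.mem_nhds hwB)
    refine ⟨n, fun m hm => ?_⟩
    apply hlp_le_antisymm
    · obtain ⟨B', hB', hwB', hsub⟩ := hw _ ((hopen m w).mem_nhds (hself m w))
      obtain ⟨v, hv, hvY⟩ := hlp_exists_pt hB' (Or.inr rfl : SQ.le q q)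
      exact hlp_mem_type (hcell m w) (hsub hv) hvY
    · obtain ⟨v, hv, hvY⟩ := hN m w
      exact hlp_mem_type hB (hn m hm hv) hvY
  · rintro q w ⟨n, hn⟩
    have := hcell n w
    rw [hn n le_rfl] at this
    exact ⟨_, this, hself n w⟩
  · rintro q w ⟨n, hn⟩
    refine hZ.2.2.1 (α q) ⟨_, by rw [← hn n le_rfl]; exact htrim n w⟩ w ?_
    intro U hU
    obtain ⟨k, hk⟩ := hmesh w U hU
    refine ⟨(x (max n k) w).1, ?_, hself _ w, hk _ (le_max_right _ _)⟩
    rw [← hn _ (le_max_left n k)]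
    exact htrim _ w
  · intro p _ A hA
    obtain ⟨w, hw, hwp⟩ := hlp_exists_pt hA (Or.inr rfl : SP.le p p)
    obtain ⟨k, hk⟩ := hmesh w A (hA.2.1.mem_nhds hw)
    obtain ⟨v, hv, hvY⟩ := hN k w
    refine ⟨(x k w).2, ⟨v, hk k le_rfl hv, hvY⟩, ?_⟩
    apply hlp_le_antisymm
    · exact hlp_mem_type (htrim k w) (hself k w) hwp
    · obtain ⟨z, hz, hzp⟩ := hlp_exists_pt (htrim k w) (Or.inr rfl)
      exact hlp_mem_type hA (hk k le_rfl hz) hzp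

theorem hlp_seq {SP : POSystem P} {SQ : POSystem Q} {Z : P → Set W} {α : Q → P} [T2Space W]
    [SecondCountableTopology W] [LocallyCompactSpace W] [TotallyDisconnectedSpace W]
    [Countable Q]
    (hZ : IsTrimPartition SP Z) (hmor : POSystem.IsMorphism SQ SP α)
    (x0 : W → Set W × Q) (h0 : HGood SP Z α univ x0) (H7 : ∀ q, ∃ w, SQ.le (x0 w).2 q) :
    ∃ Y : Q → Set W, IsTrimPartition SQ Y ∧ RegRefines SQ SP Y Z α := by
  obtain ⟨C, hCc, hC⟩ : ∃ C : ℕ → Set W, (∀ n, IsClopen (C n)) ∧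
      ∀ w : W, ∀ U ∈ nhds w, ∃ n, w ∈ C n ∧ C n ⊆ U := by
    obtain ⟨b, hb1, hb2, hb3⟩ :=
      (loc_compact_Haus_tot_disc_of_zero_dim (H := W)).exists_countable
    have hb1' : (insert ∅ b).Countable := hb2.insert ∅
    obtain ⟨C, hC⟩ := hb1'.exists_eq_range (insert_nonempty _ _)
    refine ⟨C, ?_, ?_⟩
    · intro n
      have : C n ∈ insert ∅ b := by rw [hC]; exact ⟨n, rfl⟩
      rcases this with h | h
      · rw [h]; exact isClopen_empty
      · exact hb1 h
    · intro w U hU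
      obtain ⟨v, hv, hwv, hvU⟩ := hb3.mem_nhds_iff.1 hU
      have : v ∈ range C := by rw [← hC]; exact Or.inr hv
      obtain ⟨n, rfl⟩ := this
      exact ⟨n, hwv, hvU⟩
  by_cases hQ : Nonempty Q
  swap
  · have : IsEmpty Q := not_nonempty_iff.1 hQ
    have hW : IsEmpty W := ⟨fun w => this.false (x0 w).2⟩
    refine ⟨fun _ => ∅, ⟨⟨fun q => (this.false q).elim, fun q => (this.false q).elim,
      fun q => (this.false q).elim⟩, fun w => (hW.false w).elim, fun q => (this.false q).elim,
      fun q => (this.false q).elim⟩, fun q => (this.false q).elim, ?_⟩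
    intro p _ A hA
    obtain ⟨w, -⟩ := hlp_exists_pt hA (Or.inr rfl)
    exact (hW.false w).elim
  obtain ⟨s, hs⟩ := exists_surjective_nat Q
  let r : ℕ → Q := fun n => s n.unpair.1
  have hr : ∀ q n, ∃ m, n ≤ m ∧ r m = q := by
    intro q n
    obtain ⟨k, hk⟩ := hs q
    exact ⟨Nat.pair k n, Nat.right_le_pair _ _, by simp [r, hk]⟩
  have hstep : ∀ (n : ℕ) (a : Set W × Q), ∃ y : W → Set W × Q, IsTrimAt SP Z a.1 (α a.2) →
      HGood SP Z α a.1 y ∧ (∀ w ∈ a.1, SQ.le a.2 (y w).2) ∧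
      (∀ w ∈ a.1, w ∈ C n → (y w).1 ⊆ C n) ∧ (∃ w ∈ a.1, (y w).2 = a.2) ∧
      (¬ SQ.lt a.2 a.2 → ∀ w ∈ a.1, ∀ w' ∈ a.1, (y w).2 = a.2 → (y w').2 = a.2 → y w = y w') ∧
      (SQ.lt a.2 (r n) → ∃ w ∈ a.1, ∃ w' ∈ a.1, (y w).2 = r n ∧ (y w').2 = a.2 ∧
        w ∉ (y w').1) := by
    intro n a
    by_cases ha : IsTrimAt SP Z a.1 (α a.2)
    · obtain ⟨y, hy⟩ := hlp_step hZ hmor ha (hCc n) (r n)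
      exact ⟨y, fun _ => hy⟩
    · exact ⟨x0, fun h => absurd h ha⟩
  choose st hst using hstep
  let x : ℕ → W → Set W × Q := fun n => Nat.rec x0 (fun n y w => st n (y w) w) n
  have hx : ∀ n w, x (n + 1) w = st n (x n w) w := fun n w => rfl
  have H0 : ∀ n, HGood SP Z α univ (x n) := by
    intro n
    induction n with
    | zero => exact h0
    | succ n ih =>
      intro w _
      obtain ⟨k1, k2, k3, k4⟩ := ih w trivial
      obtain ⟨g1, g2, g3, g4⟩ := (hst n _ k4).1 w k1
      rw [hx]
      refine ⟨g1, subset_univ _, ?_, g4⟩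
      intro v hv
      rw [hx, k3 v (g2 hv)]
      exact g3 v hv
  have hself : ∀ n w, w ∈ (x n w).1 := fun n w => (H0 n w trivial).1
  have heq : ∀ n w, ∀ w' ∈ (x n w).1, x n w' = x n w := fun n w => (H0 n w trivial).2.2.1
  have hall := fun n w => hst n (x n w) (H0 n w trivial).2.2.2
  have hx' : ∀ n w, ∀ w' ∈ (x n w).1, x (n + 1) w' = st n (x n w) w' := by
    intro n w w' h
    rw [hx, heq n w w' h]
  refine hlp_final hZ C r x hC hr H0 ?_ ?_ ?_ ?_ ?_ ?_ H7
  · intro n w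
    exact ((hall n w).1 w (hself n w)).2.1
  · intro n w
    exact (hall n w).2.1 w (hself n w)
  · intro n w
    exact (hall n w).2.2.1 w (hself n w)
  · intro n w
    obtain ⟨w', h1, h2⟩ := (hall n w).2.2.2.1
    exact ⟨w', h1, by rw [hx' n w w' h1]; exact h2⟩
  · intro n w hq w1 h1 w2 h2
    rw [hx' n w w1 h1, hx' n w w2 h2]
    exact (hall n w).2.2.2.2.1 hq w1 h1 w2 h2
  · intro n w hq
    obtain ⟨w1, h1, w2, h2, h3⟩ := (hall n w).2.2.2.2.2 hq
    refine ⟨w1, h1, w2, h2, ?_⟩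
    rw [hx' n w w1 h1, hx' n w w2 h2]
    exact h3


theorem hlp_hull {SP : POSystem P} {Z : P → Set W}
    (hZ : IsTrimPartition SP Z) {K : Set W} (hK : IsCompact K) :
    ∃ V, IsCompact V ∧ IsOpen V ∧ K ⊆ V := by
  have h1 : ∀ w : W, ∃ A : Set W, IsCompact A ∧ IsOpen A ∧ w ∈ A := by
    intro w
    obtain ⟨A, ⟨p, h⟩, h2, -⟩ := hZ.2.1 w univ Filter.univ_mem
    exact ⟨A, h.1, h.2.1, h2⟩
  choose A hAc hAo hA using h1
  obtain ⟨t, -, ht⟩ := hK.elim_nhds_subcover A (fun w _ => (hAo w).mem_nhds (hA w))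
  exact ⟨⋃ w ∈ t, A w, t.isCompact_biUnion fun w _ => hAc w,
    isOpen_biUnion fun w _ => hAo w, ht⟩

theorem hlp_inf {SP : POSystem P} {Z : P → Set W} [T2Space W]
    (hZ : IsPPartition SP Z) {p q : P} (h : SP.lt p q) : (Z q).Infinite := by
  intro hfin
  obtain ⟨w, hw⟩ := hZ.1 p
  obtain ⟨v, hv, hvq, hne⟩ := hlp_up hZ (B := (Z q \ {w})ᶜ)
    (hfin.subset sdiff_subset).isClosed.isOpen_compl (fun h' : w ∈ Z q \ {w} => h'.2 rfl) hw h
  exact hv ⟨hvq, hne⟩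

theorem hlp_pts {SP : POSystem P} {Z : P → Set W} {α : Q → P} [T2Space W]
    {L : Set P} {f : P → ℕ} (hext : POSystem.IsExtPO SP L f) (hZ : IsTrimPLF SP L f Z)
    (hcard : ∀ p ∈ POSystem.LminD SP L, (α ⁻¹' {p}).Finite ∧ Nat.card (α ⁻¹' {p}) ≤ f p)
    {F : Set Q} (hF : F.Finite) (hFL : F ⊆ α ⁻¹' L) :
    ∃ u : Q → W, InjOn u F ∧ ∀ q ∈ F, u q ∈ Z (α q) := by
  by_cases hW : Nonempty W
  swap
  · have hQ : Q → False := fun q => hW ⟨(hZ.1.1.1 (α q)).some⟩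
    exact ⟨fun q => (hQ q).elim, fun q => (hQ q).elim, fun q => (hQ q).elim⟩
  have key : ∀ p, ∃ g : Q → W, (F ∩ α ⁻¹' {p}) ⊆ g ⁻¹' (Z p) ∧ InjOn g (F ∩ α ⁻¹' {p}) := by
    intro p
    apply Set.Finite.exists_injOn_of_encard_le (hF.inter_of_left _)
    by_cases hinf : (Z p).Infinite
    · rw [hinf.encard_eq]; exact le_top
    by_cases hne : (F ∩ α ⁻¹' {p}).Nonempty
    swap
    · rw [not_nonempty_iff_eq_empty.1 hne]; simp
    obtain ⟨q, hq, hqp⟩ := hne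
    have hpL : p ∈ L := by
      have h1 := hFL hq
      have h2 : α q = p := hqp
      rw [← h2]; exact h1
    have hp : p ∈ POSystem.LminD SP L := by
      refine ⟨⟨hpL, ?_⟩, fun h => hinf (hlp_inf hZ.1.1 h)⟩
      rintro s _ (h | h)
      · exact absurd (hlp_inf hZ.1.1 h) hinf
      · exact h
    obtain ⟨c1, c2⟩ := hcard p hp
    have c3 := hZ.2.2 p hp
    rw [not_infinite] at hinf
    calc (F ∩ α ⁻¹' {p}).encard ≤ (α ⁻¹' {p}).encard := encard_le_encard inter_subset_right
      _ = ((α ⁻¹' {p}).ncard : ℕ∞) := c1.cast_ncard_eq.symm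
      _ ≤ ((Z p).ncard : ℕ∞) := by
          have : (α ⁻¹' {p}).ncard ≤ (Z p).ncard := by
            rw [← Nat.card_coe_set_eq, ← Nat.card_coe_set_eq, c3]; exact c2
          exact_mod_cast this
      _ = (Z p).encard := hinf.cast_ncard_eq
  choose g hg1 hg2 using key
  have hm : ∀ q ∈ F, g (α q) q ∈ Z (α q) := fun q hq => hg1 (α q) ⟨hq, rfl⟩
  refine ⟨fun q => g (α q) q, ?_, hm⟩
  intro a ha b hb (hab : g (α a) a = g (α b) b)
  have e : α a = α b := by
    by_contra hne
    exact Set.disjoint_left.1 (hZ.1.1.2.1 hne) (hm a ha) (by rw [hab]; exact hm b hb)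
  refine hg2 (α b) ⟨ha, e⟩ ⟨hb, rfl⟩ ?_
  rw [e] at hab
  exact hab

theorem hlp_start {SP : POSystem P} {SQ : POSystem Q} {Z : P → Set W} {α : Q → P} [T2Space W]
    [SecondCountableTopology W] [LocallyCompactSpace W] [Countable Q]
    {L : Set P} {f : P → ℕ} (hext : POSystem.IsExtPO SP L f) (hZ : IsBoundedTrimPLF SP L f Z)
    (hsurj : Function.Surjective α) (hmor : POSystem.IsMorphism SQ SP α)
    (hfound : POSystem.HasFinFoundation SQ (α ⁻¹' L))
    (hcard : ∀ p ∈ POSystem.LminD SP L, (α ⁻¹' {p}).Finite ∧ Nat.card (α ⁻¹' {p}) ≤ f p) :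
    ∃ x0, HGood SP Z α univ x0 ∧ ∀ q, ∃ w, SQ.le (x0 w).2 q := by
  classical
  obtain ⟨F, hFfin, hFsub, hF⟩ := hfound
  have hT := hZ.1.1
  have hFL : F ⊆ α ⁻¹' L := by
    intro a ha
    obtain ⟨q, hq, hle⟩ := hFsub ha
    refine hext.1 (α q) hq (α a) ?_
    rcases hle with h | h
    · left
      have : α q ∈ α '' {r | SQ.lt a r} := ⟨q, h, rfl⟩
      rw [hmor a] at this
      exact this
    · right; rw [h]
  obtain ⟨g, hg⟩ := exists_injective_nat Q
  obtain ⟨U, hUc, hUo, hU⟩ := hlp_hull hT hZ.2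
  have hUL : ∀ p ∈ L, Z p ⊆ U := by
    intro p hp
    refine Subset.trans ?_ (subset_closure.trans hU)
    exact subset_biUnion_of_mem hp
  have hstep : ∀ (n : ℕ) (V : Set W), ∃ V', IsCompact V → IsOpen V' ∧ IsCompact V' ∧ V ⊆ V' ∧
      compactCovering W n ⊆ V' ∧
      ∀ q, α q ∉ L → g q = n → ∃ w ∈ V' \ V, w ∈ Z (α q) := by
    intro n V
    by_cases hV : IsCompact V
    swap
    · exact ⟨V, fun h => absurd h hV⟩
    by_cases hq : ∃ q, α q ∉ L ∧ g q = n
    · obtain ⟨q, hqL, hqn⟩ := hq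
      have : ¬ (Z (α q) ⊆ V) := by
        intro h
        apply hqL
        rw [← hZ.1.2.1]
        exact hV.of_isClosed_subset isClosed_closure (closure_minimal h hV.isClosed)
      obtain ⟨w, hw, hwV⟩ := not_subset.1 this
      obtain ⟨V', h1, h2, h3⟩ := hlp_hull hT ((hV.union (isCompact_compactCovering W n)).union
        (isCompact_singleton (x := w)))
      refine ⟨V', fun _ => ⟨h2, h1, fun v hv => h3 (Or.inl (Or.inl hv)),
        fun v hv => h3 (Or.inl (Or.inr hv)), ?_⟩⟩
      intro q' _ hq'
      have : q' = q := hg (hq'.trans hqn.symm)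
      subst this
      exact ⟨w, ⟨h3 (Or.inr rfl), hwV⟩, hw⟩
    · obtain ⟨V', h1, h2, h3⟩ := hlp_hull hT (hV.union (isCompact_compactCovering W n))
      refine ⟨V', fun _ => ⟨h2, h1, fun v hv => h3 (Or.inl hv), fun v hv => h3 (Or.inr hv), ?_⟩⟩
      intro q' h h'
      exact absurd ⟨q', h, h'⟩ hq
  choose nx hnx using hstep
  let V : ℕ → Set W := fun n => Nat.rec (motive := fun _ => Set W) U (fun n V => nx n V) n
  have hVs : ∀ n, V (n + 1) = nx n (V n) := fun n => rfl
  have hVc : ∀ n, IsCompact (V n) := by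
    intro n
    induction n with
    | zero => exact hUc
    | succ n ih => exact (hnx n _ ih).2.1
  have hV := fun n => hnx n (V n) (hVc n)
  have hVo : ∀ n, IsOpen (V n) := by
    intro n
    cases n with
    | zero => exact hUo
    | succ n => exact (hV n).1
  have hVm : Monotone V := monotone_nat_of_le_succ fun n => (hV n).2.2.1
  have hcov : ∀ w : W, ∃ n : ℕ, w ∈ V n := by
    intro w
    have : w ∈ ⋃ n, compactCovering W n := by rw [iUnion_compactCovering]; trivial
    obtain ⟨n, hn⟩ := mem_iUnion.1 this
    exact ⟨n + 1, (hV n).2.2.2.1 hn⟩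
  have hdec : ∀ w : W, DecidablePred fun n => w ∈ V n := fun w => Classical.decPred _
  let N : W → ℕ := fun w => @Nat.find _ (hdec w) (hcov w)
  have hN0 : N ⁻¹' {0} = U := by
    ext w
    show @Nat.find _ (hdec w) (hcov w) = 0 ↔ w ∈ U
    exact Nat.find_eq_zero (hcov w)
  have hNs : ∀ n, N ⁻¹' {n + 1} = V (n + 1) \ V n := by
    intro n
    ext w
    show @Nat.find _ (hdec w) (hcov w) = n + 1 ↔ (w ∈ V (n + 1) ∧ w ∉ V n)
    refine (Nat.find_eq_iff (hcov w)).trans ?_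
    refine and_congr_right fun _ => ⟨fun h => h n (by omega), fun h m hm hw => ?_⟩
    exact h (hVm (by omega) hw)
  have hpieces : ∀ n, ∃ x, HGood SP Z α (univ ∩ N ⁻¹' {n}) x ∧
      (n = 0 → ∀ q ∈ F, ∃ w ∈ N ⁻¹' {n}, (x w).2 = q) ∧
      (∀ q, α q ∉ L → n = g q + 1 → ∃ w ∈ N ⁻¹' {n}, (x w).2 = q) := by
    intro n
    rw [univ_inter]
    cases n with
    | zero =>
      rw [hN0]
      obtain ⟨u, hu1, hu2⟩ := hlp_pts hext hZ.1 hcard hFfin hFL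
      obtain ⟨x, hx, hx2⟩ := hlp_init hT hsurj hFfin u U hUc hUo hu1
        (fun q hq => ⟨hUL (α q) (hFL hq) (hu2 q hq), hu2 q hq⟩)
      exact ⟨x, hx, fun _ => hx2, fun q _ h => by omega⟩
    | succ n =>
      rw [hNs]
      have hc : IsCompact (V (n + 1) \ V n) := (hVc (n + 1)).diff (hVo n)
      have ho : IsOpen (V (n + 1) \ V n) := (hVo (n + 1)).sdiff (hVc n).isClosed
      by_cases hq : ∃ q, α q ∉ L ∧ g q = n
      · obtain ⟨q, hqL, hqn⟩ := hq
        obtain ⟨w, hw, hwZ⟩ := (hV n).2.2.2.2 q hqL hqn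
        obtain ⟨x, hx, hx2⟩ := hlp_init hT hsurj (finite_singleton q) (fun _ => w) _ hc ho
          (by simp) (by rintro _ rfl; exact ⟨hw, hwZ⟩)
        refine ⟨x, hx, by simp, ?_⟩
        intro q' _ hq'
        have : q' = q := hg (by omega)
        subst this
        exact hx2 _ rfl
      · by_cases hne : Nonempty W
        · obtain ⟨x, hx, -⟩ := hlp_init (α := α) hT hsurj (finite_empty) (fun _ => hne.some) _ hc ho
            (by simp) (by simp)
          refine ⟨x, hx, by simp, fun q' h h' => absurd ⟨q', h, by omega⟩ hq⟩
        · exact ⟨fun w => (hne ⟨w⟩).elim, fun w => (hne ⟨w⟩).elim, by simp,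
            fun q' h h' => absurd ⟨q', h, by omega⟩ hq⟩
  choose x hx1 hx2 hx3 using hpieces
  refine ⟨_, hlp_glue N x univ hx1, ?_⟩
  intro q
  by_cases hq : α q ∈ L
  · obtain ⟨a, ha, hle⟩ := hF q ⟨q, hq, Or.inr rfl⟩
    obtain ⟨w, hw, e⟩ := hx2 0 rfl a ha
    refine ⟨w, ?_⟩
    have : N w = 0 := hw
    rw [this, e]
    exact hle
  · obtain ⟨w, hw, e⟩ := hx3 _ q hq rfl
    refine ⟨w, ?_⟩
    have : N w = g q + 1 := hw
    rw [this, e]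
    exact Or.inr rfl

theorem hlp_forward {SP : POSystem P} {SQ : POSystem Q} {Z : P → Set W} {α : Q → P} [T2Space W]
    {L : Set P} {f : P → ℕ} (hext : POSystem.IsExtPO SP L f) (hZ : IsBoundedTrimPLF SP L f Z)
    (hmor : POSystem.IsMorphism SQ SP α)
    {Y : Q → Set W} (hY : IsTrimPartition SQ Y) (hR : Refines Y Z α) :
    POSystem.HasFinFoundation SQ (α ⁻¹' L) ∧
      ∀ p ∈ POSystem.LminD SP L, (α ⁻¹' {p}).Finite ∧ Nat.card (α ⁻¹' {p}) ≤ f p := by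
  classical
  constructor
  · have h1 : ∀ w, ∃ A q, IsTrimAt SQ Y A q ∧ w ∈ A := by
      intro w
      obtain ⟨A, ⟨q, h⟩, h2, -⟩ := hY.2.1 w univ Filter.univ_mem
      exact ⟨A, q, h, h2⟩
    choose A l hA hwA using h1
    obtain ⟨t, -, ht⟩ := hZ.2.elim_nhds_subcover A (fun w _ => (hA w).2.1.mem_nhds (hwA w))
    have hdown : ∀ q ∈ POSystem.downSet SQ (α ⁻¹' L), α q ∈ L := by
      rintro a ⟨q, hq, hle⟩
      refine hext.1 (α q) hq (α a) ?_
      rcases hle with h | h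
      · left
        have : α q ∈ α '' {r | SQ.lt a r} := ⟨q, h, rfl⟩
        rw [hmor a] at this
        exact this
      · right; rw [h]
    refine ⟨(l '' t) ∩ POSystem.downSet SQ (α ⁻¹' L), (t.finite_toSet.image l).inter_of_left _,
      inter_subset_right, ?_⟩
    intro q hq
    obtain ⟨v, hv⟩ := hY.1.1 q
    have : v ∈ closure (⋃ p ∈ L, Z p) := subset_closure (mem_biUnion (hdown q hq) (hR q hv))
    have := ht this
    simp only [mem_iUnion] at this
    obtain ⟨w, hw, hvA⟩ := this
    have hle := hlp_mem_type (hA w) hvA hv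
    refine ⟨l w, ⟨⟨w, hw, rfl⟩, q, hdown q hq, hle⟩, hle⟩
  · intro p hp
    have hc := hZ.1.2.2 p hp
    have hpos := hext.2.2 p hp
    have hfin : Finite (Z p) := Nat.finite_of_card_ne_zero (by omega)
    have hm : ∀ q : α ⁻¹' {p}, ∃ z : Z p, (z : W) ∈ Y q := by
      rintro ⟨q, hq⟩
      obtain ⟨v, hv⟩ := hY.1.1 q
      have e : α q = p := hq
      exact ⟨⟨v, by rw [← e]; exact hR q hv⟩, hv⟩
    choose z hz using hm
    have hinj : Function.Injective z := by
      intro a b hab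
      by_contra hne
      have hne' : (a : Q) ≠ b := fun h => hne (Subtype.ext h)
      exact Set.disjoint_left.1 (hY.1.2.1 hne') (hz a) (by rw [hab]; exact hz b)
    refine ⟨Set.finite_coe_iff.1 (Finite.of_injective z hinj), ?_⟩
    rw [← hc]
    exact Nat.card_le_card_of_injective z hinj

end Helpers

/-- a bounded trim `(P, L, f)`-partition can be regularly refined to a trim
`Q`-partition along the surjective morphism `α` iff `α⁻¹(L)` has a finite foundation and
`|α⁻¹(p)| ≤ f(p)` for every `p ∈ L_min^d`. -/
theorem refinement_condition {P : Type u} {Q : Type v} {W : Type*}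
    [Countable P] [Countable Q]
    [TopologicalSpace W] [SecondCountableTopology W] [LocallyCompactSpace W]
    [T2Space W] [TotallyDisconnectedSpace W]
    (SP : POSystem P) (SQ : POSystem Q) (α : Q → P)
    (hsurj : Function.Surjective α) (hmor : POSystem.IsMorphism SQ SP α)
    (L : Set P) (f : P → ℕ) (hext : POSystem.IsExtPO SP L f)
    (Z : P → Set W) (hZ : IsBoundedTrimPLF SP L f Z) :
    (∃ Y : Q → Set W, IsTrimPartition SQ Y ∧ RegRefines SQ SP Y Z α) ↔
      (POSystem.HasFinFoundation SQ (α ⁻¹' L) ∧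
        ∀ p ∈ POSystem.LminD SP L, (α ⁻¹' {p}).Finite ∧ Nat.card (α ⁻¹' {p}) ≤ f p) := by
  constructor
  · rintro ⟨Y, hY, hR⟩
    exact hlp_forward hext hZ hmor hY hR.1
  · rintro ⟨h1, h2⟩
    obtain ⟨x0, hx0, hx1⟩ := hlp_start hext hZ hsurj hmor h1 h2
    exact hlp_seq hZ.1.1 hmor x0 hx0 hx1
end

section
/- Let W be an ω-Stone space, P a PO system and 𝒳 a complete P-partition of W. Then 𝒳 is a rank P-partition of W if and only if 𝒳 is a strongly semi-trim P-partition and every element of P̂ is compact in P. -/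
open Set Filter Topology

universe u v

open POSystem

section Helpers

variable {W : Type*} [TopologicalSpace W] {P : Type*} {S : POSystem P} {X : P → Set W}

theorem hp_le_refl (S : POSystem P) (a : P) : S.le a a := Or.inr rfl

theorem hp_le_antisymm {a b : P} (h1 : S.le a b) (h2 : S.le b a) : a = b := by
  rcases h1 with h1 | h1
  · rcases h2 with h2 | h2
    · exact S.lt_antisymm h1 h2
    · exact h2.symm
  · exact h1

theorem hp_ex (hcomp : IsCompletePartition X) (x : W) : ∃ p, x ∈ X p := by
  have : x ∈ ⋃ p, X p := by rw [hcomp]; trivial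
  simpa using this

theorem hp_uniq (hpart : IsPPartition S X) {x : W} {p q : P} (hp : x ∈ X p) (hq : x ∈ X q) :
    p = q := by
  by_contra h
  exact Set.disjoint_left.1 (hpart.2.1 h) hp hq

theorem hp_limit (hpart : IsPPartition S X) {x : W} {p q : P} (hq : x ∈ X q) :
    x ∈ limitPts (X p) ↔ S.lt q p := by
  have h := hpart.2.2 p
  constructor
  · intro hx
    have : x ∈ limitPts (X p) ∩ (⋃ q, X q) := ⟨hx, mem_iUnion.2 ⟨q, hq⟩⟩
    rw [h] at this
    simp only [mem_setOf_eq, mem_iUnion] at this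
    obtain ⟨r, hr, hxr⟩ := this
    rwa [hp_uniq hpart hq hxr]
  · intro hlt
    have : x ∈ ⋃ q ∈ {q : P | S.lt q p}, X q := by
      simp only [mem_setOf_eq, mem_iUnion]
      exact ⟨q, hlt, hq⟩
    rw [← h] at this
    exact this.1

theorem hp_closure (hpart : IsPPartition S X) {x : W} {p q : P} (hq : x ∈ X q) :
    x ∈ closure (X p) ↔ S.le q p := by
  constructor
  · intro hx
    by_cases hxp : x ∈ X p
    · exact Or.inr (hp_uniq hpart hq hxp)
    · left
      rw [← hp_limit hpart hq]
      unfold limitPts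
      rw [mem_setOf_eq, diff_singleton_eq_self hxp]
      exact hx
  · rintro (h | rfl)
    · have := (hp_limit hpart hq).2 h
      exact closure_mono diff_subset this
    · exact subset_closure hq

theorem hp_upper (hpart : IsPPartition S X) {U : Set W} (hU : IsOpen U) {x : W} {p q : P}
    (hx : x ∈ U) (hq : x ∈ X q) (h : S.le q p) : (U ∩ X p).Nonempty :=
  mem_closure_iff.1 ((hp_closure hpart hq).2 h) U hU hx

theorem hp_not_lt (hpart : IsPPartition S X) {x : W} {p q : P} (hq : x ∈ X q)
    (h : ¬ S.lt q p) : ∃ V, IsOpen V ∧ x ∈ V ∧ ∀ y ∈ V, y ∈ X p → y = x := by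
  rw [← hp_limit hpart hq] at h
  refine ⟨(closure (X p \ {x}))ᶜ, isClosed_closure.isOpen_compl, h, ?_⟩
  intro y hy hyp
  by_contra hne
  exact hy (subset_closure ⟨hyp, hne⟩)

theorem hp_nhd [LocallyCompactSpace W] [T2Space W] [TotallyDisconnectedSpace W] {x : W}
    {U : Set W} (hU : U ∈ 𝓝 x) : ∃ A, IsCompact A ∧ IsOpen A ∧ x ∈ A ∧ A ⊆ U := by
  obtain ⟨K, hK, hKU, hKc⟩ := local_compact_nhds hU
  obtain ⟨V, hV, hxV, hVK⟩ := (loc_compact_Haus_tot_disc_of_zero_dim (H := W)).mem_nhds_iff.1 hK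
  exact ⟨V, hKc.of_isClosed_subset hV.1 hVK, hV.2, hxV, hVK.trans hKU⟩

/-- points with labels at least `q` -/
def hpUp (S : POSystem P) (X : P → Set W) (q : P) : Set W := {x | ∃ r, x ∈ X r ∧ S.le q r}

theorem hp_trim_ex {A : Set W} {p : P} (hA : IsTrimAt S X A p) : ∃ x ∈ A, x ∈ X p := by
  have : p ∈ ptype X A := by rw [hA.2.2.1]; exact hp_le_refl S p
  obtain ⟨x, h1, h2⟩ := this
  exact ⟨x, h1, h2⟩

theorem hp_trim_le {A : Set W} {p r : P} {x : W} (hA : IsTrimAt S X A p) (hx : x ∈ A)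
    (hr : x ∈ X r) : S.le p r := by
  have : r ∈ ptype X A := ⟨x, hx, hr⟩
  rw [hA.2.2.1] at this
  exact this

theorem hp_full (hpart : IsPPartition S X) (hcomp : IsCompletePartition X) : IsFull S X := by
  intro p _ w hw
  obtain ⟨r, hr⟩ := hp_ex hcomp w
  have h1 : S.le r p := by
    rw [← hp_closure hpart hr, mem_closure_iff_nhds]
    intro U hU
    obtain ⟨A, hA, _, hAU⟩ := hw U hU
    obtain ⟨x, hx, hxp⟩ := hp_trim_ex hA
    exact ⟨x, hAU hx, hxp⟩
  obtain ⟨A, hA, hwA, _⟩ := hw univ univ_mem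
  rw [hp_le_antisymm (hp_trim_le hA hwA hr) h1]
  exact hr

/-! ### from semi-trim to rank -/

/-- If `q` is compact, and `q ≤ τ x`, then some trim neighbourhood has labels above `q`. -/
theorem hp_compact_nhd (hpart : IsPPartition S X) (hT : HasTrimBases S X) {q r : P}
    (hq : CompactIn S q) {x : W} (hx : x ∈ X r) (hqr : S.le q r) :
    ∃ p A, IsTrimAt S X A p ∧ x ∈ A ∧ S.le q p := by
  have := hq {t | ∃ p A, IsTrimAt S X A p ∧ x ∈ A ∧ S.le t p} ?_ r ?_ hqr
  · exact this
  · refine ⟨?_, ?_, ?_⟩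
    · obtain ⟨A, ⟨p, hA⟩, hxA, _⟩ := hT x univ univ_mem
      exact ⟨p, p, A, hA, hxA, hp_le_refl S p⟩
    · rintro t ⟨p, A, hA, hxA, h⟩ y hy
      exact ⟨p, A, hA, hxA, POSystem.le_trans hy h⟩
    · rintro t ⟨p, A, hA, hxA, h⟩ t' ⟨p', A', hA', hxA', h'⟩
      obtain ⟨B, ⟨s, hB⟩, hxB, hBA⟩ := hT x (A ∩ A')
        ((hA.2.1.inter hA'.2.1).mem_nhds ⟨hxA, hxA'⟩)
      obtain ⟨y, hyB, hys⟩ := hp_trim_ex hB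
      exact ⟨s, ⟨s, B, hB, hxB, hp_le_refl S s⟩,
        POSystem.le_trans h (hp_trim_le hA (hBA hyB).1 hys),
        POSystem.le_trans h' (hp_trim_le hA' (hBA hyB).2 hys)⟩
  · refine ⟨?_, ?_⟩
    · rintro t ⟨p, A, hA, hxA, h⟩
      exact POSystem.le_trans h (hp_trim_le hA hxA hx)
    · intro s hs
      rw [← hp_closure hpart hx, mem_closure_iff_nhds]
      intro U hU
      obtain ⟨A, ⟨p, hA⟩, hxA, hAU⟩ := hT x U hU
      have h1 : S.le p s := hs p ⟨p, A, hA, hxA, hp_le_refl S p⟩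
      have h2 : s ∈ ptype X A := by rw [hA.2.2.1]; exact h1
      obtain ⟨y, hy, hys⟩ := h2
      exact ⟨y, hAU hy, hys⟩

theorem hp_compact_sep {p : P} (hp : CompactIn S p) : Separated S p := by
  rintro ⟨u, hu, hsup⟩
  have hmono : ∀ m k, S.le (u m) (u (m + k)) := by
    intro m k
    induction k with
    | zero => exact hp_le_refl S _
    | succ k ih => exact POSystem.le_trans ih (Or.inl (hu (m + k)).1)
  have := hp {t | ∃ n, S.le t (u n)} ⟨⟨u 0, 0, hp_le_refl S _⟩, ?_, ?_⟩ p ⟨?_, ?_⟩ (hp_le_refl S p)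
  · obtain ⟨n, hn⟩ := this
    have h1 : p = u n := hp_le_antisymm hn (hsup.1 _ ⟨n, rfl⟩)
    have h2 : S.le (u (n+1)) (u n) := by rw [← h1]; exact hsup.1 _ ⟨n+1, rfl⟩
    exact (hu n).2 (hp_le_antisymm (Or.inl (hu n).1) h2)
  · rintro x ⟨n, hn⟩ y hy
    exact ⟨n, POSystem.le_trans hy hn⟩
  · rintro x ⟨n, hn⟩ y ⟨m, hm⟩
    refine ⟨u (n + m), ⟨n + m, hp_le_refl S _⟩, POSystem.le_trans hn (hmono n m), ?_⟩
    rw [add_comm]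
    exact POSystem.le_trans hm (hmono m n)
  · rintro a ⟨n, hn⟩
    exact POSystem.le_trans hn (hsup.1 _ ⟨n, rfl⟩)
  · intro q hq
    refine hsup.2 q ?_
    rintro _ ⟨n, rfl⟩
    exact hq _ ⟨n, hp_le_refl S _⟩

theorem hp_sep_hat [FirstCountableTopology W] (hpart : IsPPartition S X)
    (hT : HasTrimBases S X) {p : P} (hp : Separated S p) : p ∈ Phat S X := by
  by_contra hnot
  apply hp
  obtain ⟨w, hw⟩ := hpart.1 p
  obtain ⟨U, hU⟩ := (𝓝 w).exists_antitone_basis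
  let Z := {a : P × Set W // IsTrimAt S X a.2 a.1 ∧ w ∈ a.2}
  have step : ∀ (n : ℕ) (a : Z), ∃ b : Z, b.1.2 ⊆ U n ∧ S.lt a.1.1 b.1.1 ∧ a.1.1 ≠ b.1.1 := by
    rintro n ⟨⟨t, A⟩, hA, hwA⟩
    have htp : S.le t p := hp_trim_le hA hwA hw
    have hne : w ∉ closure (X t) := by
      rw [hp_closure hpart hw]
      intro h
      have := hp_le_antisymm htp h
      subst this
      exact hnot ⟨A, hA⟩
    have hV : U n ∩ (A ∩ (closure (X t))ᶜ) ∈ 𝓝 w :=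
      inter_mem (hU.1.mem_of_mem trivial)
        ((hA.2.1.inter isClosed_closure.isOpen_compl).mem_nhds ⟨hwA, hne⟩)
    obtain ⟨B, ⟨s, hB⟩, hwB, hBV⟩ := hT w _ hV
    obtain ⟨y, hyB, hys⟩ := hp_trim_ex hB
    have hts : t ≠ s := by
      rintro rfl
      exact (hBV hyB).2.2 (subset_closure hys)
    have hle : S.le t s := hp_trim_le hA (hBV hyB).2.1 hys
    refine ⟨⟨(s, B), hB, hwB⟩, fun y hy => (hBV hy).1, ?_, hts⟩
    exact hle.resolve_right hts
  choose f hf1 hf2 hf3 using step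
  obtain ⟨A, ⟨t, hA⟩, hwA, _⟩ := hT w univ univ_mem
  let g : ℕ → Z := fun n => Nat.rec ⟨(t, A), hA, hwA⟩ (fun n a => f n a) n
  have hg : ∀ n, g (n+1) = f n (g n) := fun n => rfl
  refine ⟨fun n => (g n).1.1, fun n => ?_, ?_, ?_⟩
  · simp only [hg]
    exact ⟨hf2 _ _, hf3 _ _⟩
  · rintro _ ⟨n, rfl⟩
    exact hp_trim_le (g n).2.1 (g n).2.2 hw
  · intro s hs
    rw [← hp_closure hpart hw, mem_closure_iff_nhds]
    intro V hV
    obtain ⟨n, _, hn⟩ := hU.1.mem_iff.1 hV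
    have h1 : S.le (g (n+1)).1.1 s := hs _ ⟨n+1, rfl⟩
    have h2 : s ∈ ptype X (g (n+1)).1.2 := by rw [(g (n+1)).2.1.2.2.1]; exact h1
    obtain ⟨y, hy, hys⟩ := h2
    refine ⟨y, hn ?_, hys⟩
    rw [hg] at hy
    exact hf1 _ _ hy

theorem hp_backward [FirstCountableTopology W] (hpart : IsPPartition S X)
    (hcomp : IsCompletePartition X) (hT : HasTrimBases S X)
    (hc : ∀ p ∈ Phat S X, CompactIn S p) : IsRankPartition S X := by
  refine ⟨hpart, hcomp, ?_, ?_⟩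
  · intro q hq x u r τu hx hu hlim _ hqr _
    obtain ⟨p, A, hA, hxA, hqp⟩ :=
      hp_compact_nhd hpart hT (hc q (hp_sep_hat hpart hT hq)) hx hqr
    filter_upwards [hlim.eventually (hA.2.1.mem_nhds hxA)] with k hk
    exact POSystem.le_trans hqp (hp_trim_le hA hk (hu k))
  · intro x r hx hr
    have hnot : r ∉ Phat S X := fun h => hr (hp_compact_sep (hc r h))
    obtain ⟨U, hU⟩ := (𝓝 x).exists_antitone_basis
    have : ∀ n, ∃ y ∈ U n, ∃ q, y ∈ X q ∧ S.lt q r ∧ q ≠ r := by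
      intro n
      obtain ⟨A, ⟨p, hA⟩, hxA, hAU⟩ := hT x (U n) (hU.1.mem_of_mem trivial)
      obtain ⟨y, hyA, hyp⟩ := hp_trim_ex hA
      have hne : p ≠ r := by
        rintro rfl
        exact hnot ⟨A, hA⟩
      exact ⟨y, hAU hyA, p, hyp, (hp_trim_le hA hxA hx).resolve_right hne, hne⟩
    choose y hy hy2 using this
    exact ⟨y, hU.tendsto hy, hy2⟩

/-! ### from rank to semi-trim -/

theorem hp_up_open [FirstCountableTopology W] (h : IsRankPartition S X) {q : P}
    (hq : Separated S q) : IsOpen (hpUp S X q) := by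
  obtain ⟨hpart, hcomp, h1, -⟩ := h
  rw [← isClosed_compl_iff]
  refine isClosed_of_closure_subset ?_
  rintro x hx ⟨r, hxr, hqr⟩
  obtain ⟨u, hu, hlim⟩ := mem_closure_iff_seq_limit.1 hx
  choose τ hτ using fun k => hp_ex hcomp (u k)
  have hnq : ∀ k, ¬ S.le q (τ k) := fun k hk => hu k ⟨_, hτ k, hk⟩
  have hne : ∀ k, u k ≠ x := by
    intro k hk
    exact hu k ⟨r, hk ▸ hxr, hqr⟩
  -- a general closing fact
  have key : ∀ g : ℕ ↪o ℕ, ¬ PairwiseIncompOrStrictIncr S (fun k => τ (g k)) := by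
    intro g hg
    have := h1 q hq x (fun k => u (g k)) r (fun k => τ (g k)) hxr (fun k => hτ _)
      (hlim.comp g.strictMono.tendsto_atTop) (fun k => hne _) hqr hg
    obtain ⟨k, hk⟩ := this.exists
    exact hnq _ hk
  have key2 : ∀ g : ℕ ↪o ℕ, ¬ ∀ n, 0 < n → S.le (τ (g n)) (τ (g 0)) := by
    intro g hg
    have hx0 : x ∈ closure (X (τ (g 0))) := by
      refine isClosed_closure.mem_of_tendsto (hlim.comp g.strictMono.tendsto_atTop) ?_
      filter_upwards [eventually_gt_atTop 0] with n hn
      exact (hp_closure hpart (hτ _)).2 (hg n hn)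
    exact hnq _ (POSystem.le_trans hqr ((hp_closure hpart hxr).1 hx0))
  let R : P → P → Prop := fun a b => S.lt a b ∧ a ≠ b
  have hR : IsTrans P R := ⟨fun a b c hab hbc => ⟨S.lt_trans hab.1 hbc.1, by
    rintro rfl
    exact hab.2 (S.lt_antisymm hab.1 hbc.1)⟩⟩
  let R' : P → P → Prop := fun a b => S.le b a
  have hR' : IsTrans P R' := ⟨fun a b c hab hbc => POSystem.le_trans hbc hab⟩
  obtain ⟨g, hg | hg⟩ := exists_increasing_or_nonincreasing_subseq R τ
  · exact key g (Or.inr hg)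
  obtain ⟨g', hg' | hg'⟩ := exists_increasing_or_nonincreasing_subseq R' (fun k => τ (g k))
  · exact key2 (g'.trans g) (fun n hn => hg' 0 n hn)
  · refine key (g'.trans g) (Or.inl ?_)
    intro j k hjk hle
    rcases lt_or_gt_of_ne hjk with hlt | hlt
    · rcases hle with hle | hle
      · refine hg (g' j) (g' k) (g'.strictMono hlt) ⟨hle, fun e => ?_⟩
        exact hg' j k hlt (Or.inr e.symm)
      · exact hg' j k hlt (Or.inr hle.symm)
    · exact hg' k j hlt hle

/-- every open set meets a separated label below a given one. -/
theorem hp_sep_below [LocallyCompactSpace W] [T2Space W] [TotallyDisconnectedSpace W]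
    (h : IsRankPartition S X) {x : W} {r : P} (hx : x ∈ X r) {U : Set W} (hU : U ∈ 𝓝 x) :
    ∃ y ∈ U, ∃ m, y ∈ X m ∧ S.le m r ∧ Separated S m := by
  obtain ⟨hpart, hcomp, -, h2⟩ := h
  obtain ⟨A, hAc, hAo, hxA, hAU⟩ := hp_nhd hU
  let Z := {m : P // S.le m r ∧ (A ∩ X m).Nonempty}
  obtain ⟨⟨m, hmr, y, hyA, hym⟩, hmin⟩ := exists_maximal_of_chains_bounded
    (α := Z) (r := fun a b => S.le b.1 a.1) (by
      intro c hc
      rcases c.eq_empty_or_nonempty with rfl | hne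
      · exact ⟨⟨r, hp_le_refl S r, x, hxA, hx⟩, by simp⟩
      have : Nonempty c := hne.to_subtype
      have hint : (⋂ i : c, A ∩ closure (X i.1.1)).Nonempty := by
        apply IsCompact.nonempty_iInter_of_directed_nonempty_isCompact_isClosed
        · intro i j
          have mono : ∀ a b : P, S.le a b → A ∩ closure (X a) ⊆ A ∩ closure (X b) := by
            rintro a b hab z ⟨hz, hza⟩
            obtain ⟨t, ht⟩ := hp_ex hcomp z
            rw [hp_closure hpart ht] at hza
            exact ⟨hz, (hp_closure hpart ht).2 (POSystem.le_trans hza hab)⟩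
          rcases eq_or_ne i j with rfl | hij
          · exact ⟨i, subset_rfl, subset_rfl⟩
          rcases hc i.2 j.2 (fun e => hij (Subtype.ext e)) with hl | hl
          · exact ⟨j, mono _ _ hl, subset_rfl⟩
          · exact ⟨i, subset_rfl, mono _ _ hl⟩
        · intro i
          obtain ⟨z, hz, hz'⟩ := i.1.2.2
          exact ⟨z, hz, subset_closure hz'⟩
        · intro i
          exact hAc.inter_right isClosed_closure
        · intro i
          exact hAc.isClosed.inter isClosed_closure
      obtain ⟨z, hz⟩ := hint
      rw [mem_iInter] at hz
      obtain ⟨t, ht⟩ := hp_ex hcomp z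
      have hle : ∀ a ∈ c, S.le t a.1 := fun a ha =>
        (hp_closure hpart ht).1 (hz ⟨a, ha⟩).2
      obtain ⟨a, ha⟩ := hne
      exact ⟨⟨t, POSystem.le_trans (hle a ha) a.2.1, z, (hz ⟨a, ha⟩).1, ht⟩, hle⟩)
    (fun hab hbc => POSystem.le_trans hbc hab)
  refine ⟨y, hAU hyA, m, hym, hmr, ?_⟩
  by_contra hns
  obtain ⟨u, hu, hu2⟩ := h2 y m hym hns
  obtain ⟨k, hk⟩ := (hu.eventually (hAo.mem_nhds hyA)).exists
  obtain ⟨q, hq, hqm, hne⟩ := hu2 k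
  have := hmin ⟨q, POSystem.le_trans (Or.inl hqm) hmr, u k, hk, hq⟩ (Or.inl hqm)
  exact hne (hp_le_antisymm (Or.inl hqm) this)

theorem hp_type_up (hpart : IsPPartition S X) {A : Set W} {q : P} (hA : IsOpen A)
    (hsub : A ⊆ hpUp S X q) {y : W} (hyA : y ∈ A) (hy : y ∈ X q) :
    ptype X A = {p | S.le q p} := by
  ext p
  constructor
  · rintro ⟨z, hzA, hzp⟩
    obtain ⟨t, hzt, hqt⟩ := hsub hzA
    rw [hp_uniq hpart hzp hzt]
    exact hqt
  · intro hp
    exact hp_upper hpart hA hyA hy hp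

/-- points with separated labels have bases of trim neighbourhoods -/
theorem hp_sep_clean [FirstCountableTopology W] [LocallyCompactSpace W] [T2Space W]
    [TotallyDisconnectedSpace W] (h : IsRankPartition S X) {q : P} (hq : Separated S q)
    {x : W} (hx : x ∈ X q) {U : Set W} (hU : U ∈ 𝓝 x) :
    ∃ A, IsTrimAt S X A q ∧ x ∈ A ∧ A ⊆ U := by
  have hpart := h.1
  have hup : hpUp S X q ∈ 𝓝 x := (hp_up_open h hq).mem_nhds ⟨q, hx, hp_le_refl S q⟩
  by_cases hqq : S.lt q q
  · obtain ⟨A, hAc, hAo, hxA, hAU⟩ := hp_nhd (inter_mem hU hup)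
    exact ⟨A, ⟨hAc, hAo, hp_type_up hpart hAo (fun y hy => (hAU hy).2) hxA hx,
      fun hn => absurd hqq hn⟩, hxA, fun y hy => (hAU hy).1⟩
  · obtain ⟨V, hVo, hxV, hV⟩ := hp_not_lt hpart hx hqq
    obtain ⟨A, hAc, hAo, hxA, hAU⟩ := hp_nhd (inter_mem (inter_mem hU hup) (hVo.mem_nhds hxV))
    exact ⟨A, ⟨hAc, hAo, hp_type_up hpart hAo (fun y hy => (hAU hy).1.2) hxA hx,
      fun _ => ⟨x, ⟨hxA, hx⟩, fun y hy => hV y (hAU hy.1).2 hy.2⟩⟩, hxA,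
      fun y hy => (hAU hy).1.1⟩

theorem hp_T1 [FirstCountableTopology W] [LocallyCompactSpace W] [T2Space W]
    [TotallyDisconnectedSpace W] (h : IsRankPartition S X) : HasTrimBases S X := by
  intro x U hU
  have hpart := h.1
  obtain ⟨r, hr⟩ := hp_ex h.2.1 x
  obtain ⟨O, hOU, hOo, hxO⟩ := mem_nhds_iff.1 hU
  obtain ⟨y, hyO, m, hym, hmr, hm⟩ := hp_sep_below h hr (hOo.mem_nhds hxO)
  by_cases hrm : r = m
  · subst hrm
    obtain ⟨A, hA, hxA, hAU⟩ := hp_sep_clean h hm hr hU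
    exact ⟨A, ⟨r, hA⟩, hxA, hAU⟩
  obtain ⟨B, hB, hyB, hBO⟩ := hp_sep_clean h hm hym (hOo.mem_nhds hyO)
  have hnx : x ∉ closure (X m) := by
    rw [hp_closure hpart hr]
    exact fun hl => hrm (hp_le_antisymm hl hmr)
  have hV : (O ∩ hpUp S X m) ∩ (closure (X m))ᶜ ∈ 𝓝 x :=
    ((hOo.inter (hp_up_open h hm)).inter isClosed_closure.isOpen_compl).mem_nhds
      ⟨⟨hxO, r, hr, hmr⟩, hnx⟩
  obtain ⟨C, hCc, hCo, hxC, hCV⟩ := hp_nhd hV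
  refine ⟨B ∪ C, ⟨m, hB.1.union hCc, hB.2.1.union hCo, ?_, ?_⟩, Or.inr hxC, ?_⟩
  · refine hp_type_up hpart (hB.2.1.union hCo) ?_ (Or.inl hyB) hym
    rintro z (hz | hz)
    · obtain ⟨t, ht⟩ := hp_ex h.2.1 z
      exact ⟨t, ht, hp_trim_le hB hz ht⟩
    · exact (hCV hz).1.2
  · intro hmm
    obtain ⟨z, hz, hz'⟩ := hB.2.2.2 hmm
    refine ⟨z, ⟨Or.inl hz.1, hz.2⟩, ?_⟩
    rintro w ⟨hw | hw, hwm⟩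
    · exact hz' w ⟨hw, hwm⟩
    · exact absurd (subset_closure hwm) (hCV hw).2
  · rintro z (hz | hz)
    · exact hOU (hBO hz)
    · exact hOU (hCV hz).1.1

theorem hp_hat_sep (h : IsRankPartition S X) {p : P} (hp : p ∈ Phat S X) : Separated S p := by
  obtain ⟨A, hA⟩ := hp
  by_contra hns
  obtain ⟨x, hxA, hx⟩ := hp_trim_ex hA
  obtain ⟨u, hu, hu2⟩ := h.2.2.2 x p hx hns
  obtain ⟨k, hk⟩ := (hu.eventually (hA.2.1.mem_nhds hxA)).exists
  obtain ⟨q, hq, hqm, hne⟩ := hu2 k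
  exact hne (hp_le_antisymm (Or.inl hqm) (hp_trim_le hA hk hq))

theorem hp_sep_countable [SecondCountableTopology W] (h : IsRankPartition S X) :
    {q | Separated S q}.Countable := by
  have hb := TopologicalSpace.isBasis_countableBasis W
  have hc := TopologicalSpace.countable_countableBasis W
  have : ∀ q : {q | Separated S q}, ∃ b ∈ TopologicalSpace.countableBasis W,
      b ⊆ hpUp S X q.1 ∧ ∃ y ∈ b, y ∈ X q.1 := by
    rintro ⟨q, hq⟩
    obtain ⟨y, hy⟩ := h.1.1 q
    obtain ⟨b, hb1, hb2, hb3⟩ := hb.exists_subset_of_mem_open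
      (show y ∈ hpUp S X q from ⟨q, hy, hp_le_refl S q⟩) (hp_up_open h hq)
    exact ⟨b, hb1, hb3, y, hb2, hy⟩
  choose f hf1 hf2 hf3 using this
  have : Countable (TopologicalSpace.countableBasis W) := hc.to_subtype
  have hinj : Function.Injective
      (fun q => (⟨f q, hf1 q⟩ : TopologicalSpace.countableBasis W)) := by
    have aux : ∀ a b, f a = f b → S.le a.1 b.1 := by
      intro a b hab
      obtain ⟨y, hy, hyb⟩ := hf3 b
      rw [← hab] at hy
      obtain ⟨t, ht, hat⟩ := hf2 a hy
      rwa [hp_uniq h.1 hyb ht]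
    intro a b hab
    have hab' : f a = f b := congrArg Subtype.val hab
    exact Subtype.ext (hp_le_antisymm (aux a b hab') (aux b a hab'.symm))
  exact Set.countable_coe_iff.1 hinj.countable

theorem hp_sep_compact [SecondCountableTopology W] [LocallyCompactSpace W] [T2Space W]
    [TotallyDisconnectedSpace W] (h : IsRankPartition S X) {p : P} (hp : Separated S p) :
    CompactIn S p := by
  intro J hJ s hs hps
  by_contra hpJ
  have hpart := h.1
  obtain ⟨hJne, hJlow, hJdir⟩ := hJ
  let D : Set P := {q | q ∈ J ∧ Separated S q}
  have hDc : D.Countable := (hp_sep_countable h).mono (fun q hq => hq.2)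
  -- below each element of `J` there are enough separated ones
  have hDne : D.Nonempty := by
    obtain ⟨j, hj⟩ := hJne
    obtain ⟨x, hx⟩ := hpart.1 j
    obtain ⟨y, _, m, _, hm, hms⟩ := hp_sep_below h hx univ_mem
    exact ⟨m, hJlow j hj m hm, hms⟩
  have hDdir : ∀ a ∈ D, ∀ b ∈ D, ∃ c ∈ D, S.le a c ∧ S.le b c := by
    rintro a ⟨haJ, ha⟩ b ⟨hbJ, hb⟩
    obtain ⟨j, hj, haj, hbj⟩ := hJdir a haJ b hbJ
    obtain ⟨x, hx⟩ := hpart.1 j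
    obtain ⟨y, hy, m, hym, hmj, hm⟩ := hp_sep_below h hx
      (((hp_up_open h ha).inter (hp_up_open h hb)).mem_nhds ⟨⟨j, hx, haj⟩, ⟨j, hx, hbj⟩⟩)
    obtain ⟨⟨t, ht, hat⟩, ⟨t', ht', hbt⟩⟩ := hy
    rw [← hp_uniq hpart hym ht] at hat
    rw [← hp_uniq hpart hym ht'] at hbt
    exact ⟨m, ⟨hJlow j hj m hmj, hm⟩, hat, hbt⟩
  have hDsup : ∀ t, (∀ q ∈ D, S.le q t) → S.le s t := by
    intro t ht
    refine hs.2 t ?_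
    intro j hj
    obtain ⟨x, hx⟩ := hpart.1 j
    rw [← hp_closure hpart hx, mem_closure_iff]
    intro O hO hxO
    obtain ⟨y, hy, m, hym, hmj, hm⟩ := hp_sep_below h hx (hO.mem_nhds hxO)
    exact hp_upper hpart hO hy hym (ht m ⟨hJlow j hj m hmj, hm⟩)
  obtain ⟨e, he⟩ := hDc.exists_eq_range hDne
  have heD : ∀ n, e n ∈ D := fun n => he ▸ mem_range_self n
  let Z := {a : P × Set W // a.1 ∈ D ∧ IsTrimAt S X a.2 a.1}
  have step : ∀ (n : ℕ) (a : Z), ∃ b : Z, b.1.2 ⊆ a.1.2 ∧ S.le (e n) b.1.1 := by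
    rintro n ⟨⟨q, A⟩, hqD, hA⟩
    obtain ⟨c, hc, hqc, hec⟩ := hDdir q hqD (e n) (heD n)
    obtain ⟨x, hxA, hx⟩ := hp_trim_ex hA
    obtain ⟨y, hyA, hy⟩ := hp_upper hpart hA.2.1 hxA hx hqc
    obtain ⟨B, hB, _, hBA⟩ := hp_sep_clean h hc.2 hy (hA.2.1.mem_nhds hyA)
    exact ⟨⟨(c, B), hc, hB⟩, hBA, hec⟩
  choose f hf1 hf2 using step
  obtain ⟨q, hq⟩ := hDne
  obtain ⟨x, hx⟩ := hpart.1 q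
  obtain ⟨A, hA, _, _⟩ := hp_sep_clean h hq.2 hx univ_mem
  let g : ℕ → Z := fun n => Nat.rec ⟨(q, A), hq, hA⟩ (fun n a => f n a) n
  have hg : ∀ n, g (n+1) = f n (g n) := fun n => rfl
  have hcl : IsClosed (hpUp S X p)ᶜ := (hp_up_open h hp).isClosed_compl
  obtain ⟨z, hz⟩ := IsCompact.nonempty_iInter_of_sequence_nonempty_isCompact_isClosed
    (fun n => (g n).1.2 ∩ (hpUp S X p)ᶜ)
    (by
      intro n
      apply inter_subset_inter_left
      rw [hg]
      exact hf1 _ _)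
    (by
      intro n
      obtain ⟨y, hyA, hy⟩ := hp_trim_ex (g n).2.2
      refine ⟨y, hyA, ?_⟩
      rintro ⟨t, ht, hpt⟩
      rw [← hp_uniq hpart hy ht] at hpt
      exact hpJ (hJlow _ (g n).2.1.1 _ hpt))
    ((g 0).2.2.1.inter_right hcl)
    (fun n => (g n).2.2.1.isClosed.inter hcl)
  rw [mem_iInter] at hz
  obtain ⟨t, ht⟩ := hp_ex h.2.1 z
  refine (hz 0).2 ⟨t, ht, POSystem.le_trans hps (hDsup t ?_)⟩
  intro d hd
  rw [he] at hd
  obtain ⟨n, rfl⟩ := hd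
  have h1 := hf2 n (g n)
  rw [← hg] at h1
  exact POSystem.le_trans h1 (hp_trim_le (g (n+1)).2.2 (hz (n+1)).1 ht)

end Helpers

/-- a complete `P`-partition is a rank partition iff it is strongly
semi-trim and every element of `P̂` is compact in `P`. -/
theorem rank_iff_stronglySemiTrim_and_compact {P : Type u} {W : Type v}
    [TopologicalSpace W] [SecondCountableTopology W] [LocallyCompactSpace W]
    [T2Space W] [TotallyDisconnectedSpace W]
    (S : POSystem P) (X : P → Set W)
    (hpart : IsPPartition S X) (hcomp : IsCompletePartition X) :
    IsRankPartition S X ↔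
      (IsStronglySemiTrim S X ∧ ∀ p ∈ Phat S X, POSystem.CompactIn S p) := by
  constructor
  · intro h
    refine ⟨⟨hpart, hp_T1 h, hp_full hpart hcomp, ?_⟩, fun p hp => hp_sep_compact h (hp_hat_sep h hp)⟩
    intro p hp w hw
    obtain ⟨A, hA, hwA, _⟩ := hp_sep_clean h (hp_hat_sep h hp) hw univ_mem
    exact ⟨A, hA, hwA⟩
  · rintro ⟨⟨_, hT, _, _⟩, hc⟩
    exact hp_backward hpart hcomp hT hc
end
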